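/- Let ε ∈ (0,1) be irrational and assume 1/(2π) < C(t) < ∞ for all t. Then the capacity C_ε of the channel Y_ε[i] = X[i] + W_ε[i] under the average power constraint P satisfies C_ε ≥ liminf_{n→∞} C_n, where C_n is the capacity of the channel Y_n[i] = X[i] + W_n[i] with W_n[i] = W_c(i·T_c/(p+ε_n)), ε_n = ⌊n·ε⌋/n, under the same power constraint; moreover a rate of liminf_{n→∞} C_n is achievable over the channel Y_ε when the input obeys a Gaussian distribution. -/

import Mathlib

open MeasureTheory ProbabilityTheory Filter Topology
open scoped NNReal ENNReal

/-- The law of a block of `l` samples of the memoryless zero-mean Gaussian noise whose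
variance at time `i` is `σ2 i`. -/
noncomputable def noiseMeasure (σ2 : ℕ → ℝ) (l : ℕ) : Measure (Fin l → ℝ) :=
  Measure.pi fun i : Fin l => gaussianReal 0 (σ2 (i : ℕ)).toNNReal

/-- The average power constraint `(1/l) ∑ᵢ |x[i]|² ≤ P` on a codeword `x` of blocklength `l`. -/
def powerConstraint (P : ℝ) (l : ℕ) (x : Fin l → ℝ) : Prop :=
  (1 / (l : ℝ)) * ∑ i, (x i) ^ 2 ≤ P

/-- The average probability of error of a code with `M` equiprobable messages, encoder `enc`
and decoder `dec`, and blocklength `l`, over the memoryless additive Gaussian noise channel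
`Y[i] = x[i] + W[i]` with noise variances `σ2`. -/
noncomputable def avgError (σ2 : ℕ → ℝ) (l M : ℕ)
    (enc : Fin M → Fin l → ℝ) (dec : (Fin l → ℝ) → Fin M) : ℝ :=
  (1 / (M : ℝ)) * ∑ u : Fin M,
    ((noiseMeasure σ2 l) {w | dec (fun i => enc u i + w i) ≠ u}).toReal

/-- A rate `R_s` is achievable if, for every `η₁, η₂ > 0` and every sufficiently large
blocklength `l`, there is a code whose (power-constrained) codewords have average error
probability below `η₁` and rate `log₂(M)/l ≥ R_s − η₂`. -/
def IsAchievableRate (σ2 : ℕ → ℝ) (P R_s : ℝ) : Prop :=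
  ∀ η₁ > (0 : ℝ), ∀ η₂ > (0 : ℝ), ∃ l₀ : ℕ, ∀ l > l₀,
    ∃ (M : ℕ) (enc : Fin M → Fin l → ℝ) (dec : (Fin l → ℝ) → Fin M),
      (∀ u, powerConstraint P l (enc u)) ∧
      avgError σ2 l M enc dec < η₁ ∧
      Real.logb 2 (M : ℝ) / (l : ℝ) ≥ R_s - η₂

/-- The capacity of the memoryless additive Gaussian noise channel with noise variances `σ2`
under the average power constraint `P`: the supremum of all achievable rates. -/
noncomputable def capacity (σ2 : ℕ → ℝ) (P : ℝ) : ℝ :=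
  sSup {R : ℝ | IsAchievableRate σ2 P R}

/-- The scalar zero-mean Gaussian density with variance `v`. -/
noncomputable def gpdf (v x : ℝ) : ℝ :=
  (Real.sqrt (2 * Real.pi * v))⁻¹ * Real.exp (-(x ^ 2) / (2 * v))

/-- The mutual information density rate of the memoryless additive Gaussian noise channel with
a memoryless zero-mean Gaussian input (input variances `sX`, noise variances `sW`), evaluated
at the input block `x` and the noise block `w` (so `y = x + w`). -/
noncomputable def infoDensRate (sX sW : ℕ → ℝ) (k : ℕ) (x w : Fin k → ℝ) : ℝ :=
  (1 / (k : ℝ)) * ∑ i : Fin k,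
    Real.logb 2 (gpdf (sW ((i : ℕ) + 1)) (w i) /
      gpdf (sX ((i : ℕ) + 1) + sW ((i : ℕ) + 1)) (x i + w i))

/-- The joint law of `(X^{(k)}, W^{(k)})`: independent zero-mean Gaussian input entries with
variances `sX` and independent zero-mean Gaussian noise entries with variances `sW`. -/
noncomputable def inputNoiseMeasure (sX sW : ℕ → ℝ) (k : ℕ) :
    Measure ((Fin k → ℝ) × (Fin k → ℝ)) :=
  (Measure.pi fun i : Fin k => gaussianReal 0 (sX ((i : ℕ) + 1)).toNNReal).prod
    (Measure.pi fun i : Fin k => gaussianReal 0 (sW ((i : ℕ) + 1)).toNNReal)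

/-- The limit-inferior in probability of the mutual information density rates of the
memoryless Gaussian channel with Gaussian input variances `sX` and noise variances `sW`. -/
noncomputable def pliminfInfoDens (sX sW : ℕ → ℝ) : ℝ :=
  sSup {α : ℝ | Tendsto
    (fun k => ((inputNoiseMeasure sX sW k)
      {xw | infoDensRate sX sW k xw.1 xw.2 < α}).toReal) atTop (nhds 0)}


/-! ### Gaussian densities and change of measure -/

/-- The scalar information density (in nats) of the Gaussian channel. -/
noncomputable def idt (σ v x y : ℝ) : ℝ :=
  1 / 2 * Real.log (v / σ) - (y - x) ^ 2 / (2 * σ) + y ^ 2 / (2 * v)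

/-- The zero-mean Gaussian law with variance `v`. -/
noncomputable abbrev gN (v : ℝ) : Measure ℝ := gaussianReal 0 v.toNNReal

/-- The block information density (in nats). -/
noncomputable def idens {l : ℕ} (σ v x y : Fin l → ℝ) : ℝ :=
  ∑ i, idt (σ i) (v i) (x i) (y i)

lemma pi_withDensity_aux {ι : Type*} [Fintype ι] (μ : ι → Measure ℝ)
    [∀ i, IsProbabilityMeasure (μ i)] (f : ι → ℝ → ℝ≥0∞) (hf : ∀ i, Measurable (f i))
    [∀ i, SigmaFinite ((μ i).withDensity (f i))] :
    Measure.pi (fun i => (μ i).withDensity (f i)) =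
      (Measure.pi μ).withDensity (fun y => ∏ i, f i (y i)) := by
  refine Measure.pi_eq fun s hs => ?_
  rw [withDensity_apply _ (MeasurableSet.univ_pi hs),
    ← lintegral_indicator (MeasurableSet.univ_pi hs)]
  have h1 : (Set.univ.pi s).indicator (fun y : ι → ℝ => ∏ i, f i (y i)) =
      fun y => ∏ i, (s i).indicator (f i) (y i) := by
    ext y
    by_cases hy : y ∈ Set.univ.pi s
    · rw [Set.indicator_of_mem hy]
      exact Finset.prod_congr rfl fun i _ => (Set.indicator_of_mem (hy i (Set.mem_univ i)) _).symm
    · rw [Set.indicator_of_notMem hy]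
      simp only [Set.mem_pi, not_forall] at hy
      obtain ⟨i, _, hi⟩ := hy
      exact (Finset.prod_eq_zero (Finset.mem_univ i) (Set.indicator_of_notMem hi _)).symm
  rw [h1]
  have hm : ∀ i, Measurable ((s i).indicator (f i)) := fun i => (hf i).indicator (hs i)
  rw [lintegral_prod_eq_prod_lintegral_of_indepFun Finset.univ
    (fun i (y : ι → ℝ) => (s i).indicator (f i) (y i))
    (iIndepFun_pi fun i => (hm i).aemeasurable)
    (fun i => (hm i).comp (measurable_pi_apply i))]
  refine Finset.prod_congr rfl fun i _ => ?_
  rw [withDensity_apply _ (hs i), ← lintegral_indicator (hs i)]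
  have := (measurePreserving_eval μ i).lintegral_comp (hm i)
  simpa using this

lemma measurable_idt (σ v : ℝ) : Measurable (fun p : ℝ × ℝ => idt σ v p.1 p.2) := by
  unfold idt; fun_prop

lemma gpdf_ratio {σ v : ℝ} (hσ : 0 < σ) (hv : 0 < v) (x w : ℝ) :
    gpdf σ w / gpdf v (x + w) = Real.exp (idt σ v x (x + w)) := by
  unfold gpdf idt
  have h : Real.exp (1 / 2 * Real.log (v / σ)) = Real.sqrt (2 * Real.pi * v) /
      Real.sqrt (2 * Real.pi * σ) := by
    rw [← Real.sqrt_div (by positivity), mul_div_mul_left _ _ (by positivity),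
      Real.sqrt_eq_rpow, Real.rpow_def_of_pos (by positivity), mul_comm]
  rw [Real.exp_add, Real.exp_sub, h]
  have e : x + w - x = w := by ring
  rw [e, show -w ^ 2 / (2 * σ) = -(w ^ 2 / (2 * σ)) by ring,
    show -(x + w) ^ 2 / (2 * v) = -((x + w) ^ 2 / (2 * v)) by ring, Real.exp_neg, Real.exp_neg]
  have : 0 < Real.sqrt (2 * Real.pi * v) := Real.sqrt_pos.2 (by positivity)
  have : 0 < Real.sqrt (2 * Real.pi * σ) := Real.sqrt_pos.2 (by positivity)
  field_simp

lemma gaussianPDFReal_eq_gpdf {v : ℝ} (hv : 0 < v) (m y : ℝ) :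
    gaussianPDFReal m v.toNNReal y = gpdf v (y - m) := by
  simp [gaussianPDFReal, gpdf, Real.coe_toNNReal _ hv.le]

lemma gaussian_withDensity {σ v : ℝ} (hσ : 0 < σ) (hv : 0 < v) (x : ℝ) :
    gaussianReal x σ.toNNReal =
      (gN v).withDensity (fun y => ENNReal.ofReal (Real.exp (idt σ v x y))) := by
  have h1 : σ.toNNReal ≠ 0 := by simpa using hσ
  have h2 : v.toNNReal ≠ 0 := by simpa using hv
  rw [gN, gaussianReal_of_var_ne_zero _ h1, gaussianReal_of_var_ne_zero _ h2,
    ← withDensity_mul _ (by fun_prop) (by unfold idt; fun_prop)]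
  congr 1
  ext y
  simp only [Pi.mul_apply, gaussianPDF]
  rw [← ENNReal.ofReal_mul (gaussianPDFReal_nonneg _ _ _), gaussianPDFReal_eq_gpdf hσ,
    gaussianPDFReal_eq_gpdf hv]
  have := gpdf_ratio hσ hv x (y - x)
  rw [show x + (y - x) = y by ring] at this
  rw [← this, sub_zero]
  have : gpdf v y ≠ 0 := by unfold gpdf; positivity
  field_simp

lemma channel_withDensity {l : ℕ} {σ v : Fin l → ℝ} (hσ : ∀ i, 0 < σ i) (hv : ∀ i, 0 < v i)
    (x : Fin l → ℝ) :
    (Measure.pi fun i => gN (σ i)).map (fun w i => x i + w i) =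
      (Measure.pi fun i => gN (v i)).withDensity
        (fun y => ENNReal.ofReal (Real.exp (idens σ v x y))) := by
  have hmp : ∀ i, (gN (σ i)).map (fun w => x i + w) =
      (gN (v i)).withDensity (fun y => ENNReal.ofReal (Real.exp (idt (σ i) (v i) (x i) y))) := by
    intro i
    rw [gN, gaussianReal_map_const_add, zero_add, gaussian_withDensity (hσ i) (hv i)]
  have hp : ∀ i, IsProbabilityMeasure ((gN (σ i)).map (fun w => x i + w)) := fun i =>
    Measure.isProbabilityMeasure_map (by fun_prop)
  rw [Measure.pi_map_pi (f := fun i w => x i + w) (fun i => by fun_prop)]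
  have hs : ∀ i, SigmaFinite ((gN (v i)).withDensity
      (fun y => ENNReal.ofReal (Real.exp (idt (σ i) (v i) (x i) y)))) := by
    intro i
    rw [← hmp i]; infer_instance
  rw [show (fun i => (gN (σ i)).map (fun w => x i + w)) = fun i => (gN (v i)).withDensity
      (fun y => ENNReal.ofReal (Real.exp (idt (σ i) (v i) (x i) y))) from funext hmp,
    pi_withDensity_aux _ _ (fun i => by unfold idt; fun_prop)]
  congr 1
  ext y
  rw [idens, Real.exp_sum, ENNReal.ofReal_prod_of_nonneg (fun i _ => (Real.exp_pos _).le)]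

lemma measurable_idens {l : ℕ} (σ v : Fin l → ℝ) :
    Measurable (fun p : (Fin l → ℝ) × (Fin l → ℝ) => idens σ v p.1 p.2) := by
  unfold idens idt; fun_prop

lemma measurable_idens_right {l : ℕ} (σ v x : Fin l → ℝ) :
    Measurable (fun y => idens σ v x y) := by
  unfold idens idt; fun_prop

lemma channel_conv_bound {l : ℕ} {σ v : Fin l → ℝ} (hσ : ∀ i, 0 < σ i) (hv : ∀ i, 0 < v i)
    (x : Fin l → ℝ) (γ : ℝ) {A : Set (Fin l → ℝ)} (hA : MeasurableSet A) :
    (Measure.pi fun i => gN (σ i)) {w | (fun i => x i + w i) ∈ A} ≤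
      (Measure.pi fun i => gN (σ i)) {w | γ < idens σ v x (fun i => x i + w i)} +
        ENNReal.ofReal (Real.exp γ) * (Measure.pi fun i => gN (v i)) A := by
  have hm : Measurable (fun (w : Fin l → ℝ) i => x i + w i) := by fun_prop
  have hB : MeasurableSet {y | γ < idens σ v x y} :=
    measurableSet_lt measurable_const (measurable_idens_right σ v x)
  have e1 : (Measure.pi fun i => gN (σ i)) {w | (fun i => x i + w i) ∈ A} =
      (Measure.pi fun i => gN (σ i)).map (fun w i => x i + w i) A := by
    rw [Measure.map_apply hm hA]; rfl
  have e2 : (Measure.pi fun i => gN (σ i)) {w | γ < idens σ v x (fun i => x i + w i)} =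
      (Measure.pi fun i => gN (σ i)).map (fun w i => x i + w i) {y | γ < idens σ v x y} := by
    rw [Measure.map_apply hm hB]; rfl
  rw [e1, e2]
  have hsub : A ⊆ {y | γ < idens σ v x y} ∪ (A ∩ {y | γ < idens σ v x y}ᶜ) := by
    intro y hy
    by_cases h : γ < idens σ v x y
    · exact Or.inl h
    · exact Or.inr ⟨hy, h⟩
  refine (measure_mono hsub).trans ((measure_union_le _ _).trans ?_)
  gcongr
  rw [channel_withDensity hσ hv, withDensity_apply _ (hA.inter hB.compl)]
  calc _ ≤ ∫⁻ y in A ∩ {y | γ < idens σ v x y}ᶜ, ENNReal.ofReal (Real.exp γ)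
        ∂(Measure.pi fun i => gN (v i)) := by
        refine setLIntegral_mono measurable_const fun y hy => ?_
        have : idens σ v x y ≤ γ := not_lt.1 hy.2
        gcongr
    _ ≤ _ := by
        rw [setLIntegral_const]
        gcongr
        exact Set.inter_subset_left

lemma channel_ach_bound {l : ℕ} {σ v : Fin l → ℝ} (hσ : ∀ i, 0 < σ i) (hv : ∀ i, 0 < v i)
    (x : Fin l → ℝ) (γ : ℝ) :
    (Measure.pi fun i => gN (v i)) {y | γ < idens σ v x y} ≤ ENNReal.ofReal (Real.exp (-γ)) := by
  have hm : Measurable (fun (w : Fin l → ℝ) i => x i + w i) := by fun_prop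
  have hB : MeasurableSet {y | γ < idens σ v x y} :=
    measurableSet_lt measurable_const (measurable_idens_right σ v x)
  have h1 : (Measure.pi fun i => gN (σ i)).map (fun w i => x i + w i) {y | γ < idens σ v x y}
      ≤ 1 := by
    have := Measure.isProbabilityMeasure_map (μ := Measure.pi fun i => gN (σ i)) hm.aemeasurable
    exact prob_le_one
  rw [channel_withDensity hσ hv, withDensity_apply _ hB] at h1
  have h2 : ENNReal.ofReal (Real.exp γ) * (Measure.pi fun i => gN (v i)) {y | γ < idens σ v x y}
      ≤ 1 := by
    refine le_trans ?_ h1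
    rw [← setLIntegral_const]
    refine setLIntegral_mono ?_ fun y hy => ?_
    · exact (measurable_idens_right σ v x).exp.ennreal_ofReal
    · have : γ < idens σ v x y := hy
      gcongr
  rw [Real.exp_neg, ENNReal.ofReal_inv_of_pos (Real.exp_pos _), ← one_div]
  rw [ENNReal.le_div_iff_mul_le (Or.inl (by simp [Real.exp_pos])) (Or.inl (by simp)), mul_comm]
  exact h2

/-! ### Moments and Chebyshev -/

/-- The fourth moment of the standard Gaussian. -/
noncomputable def K4 : ℝ := ∫ x, x ^ 4 ∂(gaussianReal 0 1)

lemma K4_nonneg : 0 ≤ K4 := integral_nonneg fun x => by positivity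

lemma memLp_sq_gN (v : ℝ) : MemLp (fun w : ℝ => w ^ 2) 2 (gN v) := by
  have h := memLp_id_gaussianReal' (μ := 0) (v := v.toNNReal) 4 (by simp)
  have h4 : Integrable (fun w : ℝ => w ^ 4) (gN v) := by
    have := h.integrable_norm_pow (p := 4) (by norm_num)
    refine this.congr (ae_of_all _ fun x => ?_)
    simp [Even.pow_abs (by decide : Even 4)]
  rw [memLp_two_iff_integrable_sq (by fun_prop)]
  refine h4.congr (ae_of_all _ fun x => ?_)
  simp only; ring

lemma integrable_four_gN (v : ℝ) : Integrable (fun w : ℝ => w ^ 4) (gN v) := by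
  refine (memLp_sq_gN v).integrable_sq.congr (ae_of_all _ fun x => ?_)
  simp only; ring

lemma memLp_id_gN (v : ℝ) : MemLp (fun w : ℝ => w) 2 (gN v) :=
  memLp_id_gaussianReal' 2 (by simp)

lemma integral_sq_gN {v : ℝ} (hv : 0 ≤ v) : ∫ w, w ^ 2 ∂(gN v) = v := by
  have h := variance_fun_id_gaussianReal (μ := 0) (v := v.toNNReal)
  rw [variance_of_integral_eq_zero (by fun_prop) (by simp)] at h
  rw [h, Real.coe_toNNReal _ hv]

lemma integral_id_gN (v : ℝ) : ∫ w, w ∂(gN v) = 0 := integral_id_gaussianReal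

lemma integral_four_gN {v : ℝ} (hv : 0 ≤ v) : ∫ w, w ^ 4 ∂(gN v) = K4 * v ^ 2 := by
  have h : gN v = (gaussianReal 0 1).map (fun x => Real.sqrt v * x) := by
    rw [gaussianReal_map_const_mul, gN]
    congr 1
    · simp
    · ext
      simp [Real.sq_sqrt hv, hv]
  rw [h, integral_map (by fun_prop) (by fun_prop), K4, mul_comm, ← integral_const_mul]
  congr 1
  ext x
  have : Real.sqrt v ^ 4 = v ^ 2 := by
    rw [show Real.sqrt v ^ 4 = (Real.sqrt v ^ 2) ^ 2 by ring, Real.sq_sqrt hv]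
  rw [mul_pow, this]

lemma cheb_pi {ι : Type*} [Fintype ι] {Ω : ι → Type*} {mΩ : ∀ i, MeasurableSpace (Ω i)}
    (μ : (i : ι) → Measure (Ω i)) [∀ i, IsProbabilityMeasure (μ i)]
    (X : ∀ i, Ω i → ℝ) (h : ∀ i, MemLp (X i) 2 (μ i)) (V : ι → ℝ)
    (hV : ∀ i, Var[X i; μ i] ≤ V i) {c : ℝ} (hc : 0 < c) :
    (Measure.pi μ) {ω | c ≤ |∑ i, X i (ω i) - ∑ i, ∫ y, X i y ∂(μ i)|} ≤
      ENNReal.ofReal ((∑ i, V i) / c ^ 2) := by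
  have hc' : ∀ i, MemLp (fun ω : ∀ i, Ω i => X i (ω i)) 2 (Measure.pi μ) := fun i =>
    (h i).comp_measurePreserving (measurePreserving_eval μ i)
  have hm : MemLp (∑ i, fun ω : ∀ i, Ω i => X i (ω i)) 2 (Measure.pi μ) :=
    memLp_finsetSum' _ fun i _ => hc' i
  have hE : (∫ ω, (∑ i, fun ω : ∀ i, Ω i => X i (ω i)) ω ∂(Measure.pi μ)) =
      ∑ i, ∫ y, X i y ∂(μ i) := by
    simp only [Finset.sum_apply]
    rw [integral_finsetSum _ fun i _ => (hc' i).integrable (by norm_num)]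
    exact Finset.sum_congr rfl fun i _ => integral_comp_eval (h i).aestronglyMeasurable
  have := meas_ge_le_variance_div_sq hm hc
  rw [hE, variance_sum_pi h] at this
  simp only [Finset.sum_apply] at this
  refine this.trans (ENNReal.ofReal_le_ofReal ?_)
  gcongr with i
  exact hV i

lemma conv_gN {s σ : ℝ} (hs : 0 ≤ s) (hσ : 0 ≤ σ) :
    MeasurePreserving (fun p : ℝ × ℝ => p.1 + p.2) ((gN s).prod (gN σ)) (gN (s + σ)) := by
  refine ⟨by fun_prop, ?_⟩
  have := gaussianReal_conv_gaussianReal (m₁ := 0) (m₂ := 0) (v₁ := s.toNNReal)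
    (v₂ := σ.toNNReal)
  rw [← Real.toNNReal_add hs hσ, add_zero] at this
  exact this

/-- the information density for random input: moments -/
lemma pair_moments {s σ : ℝ} (hs : 0 ≤ s) (hσ : 0 < σ) :
    MemLp (fun p : ℝ × ℝ => idt σ (s + σ) p.1 (p.1 + p.2)) 2 ((gN s).prod (gN σ)) ∧
    ∫ p, idt σ (s + σ) p.1 (p.1 + p.2) ∂((gN s).prod (gN σ)) =
      1 / 2 * Real.log ((s + σ) / σ) ∧
    Var[fun p : ℝ × ℝ => idt σ (s + σ) p.1 (p.1 + p.2); (gN s).prod (gN σ)] ≤ K4 := by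
  set v := s + σ with hv
  have hv0 : 0 < v := by positivity
  set μ := (gN s).prod (gN σ)
  have p1 : MeasurePreserving (fun p : ℝ × ℝ => p.1 + p.2) μ (gN v) := conv_gN hs hσ.le
  have p2 : MeasurePreserving (fun p : ℝ × ℝ => p.2) μ (gN σ) := measurePreserving_snd
  have m1 : MemLp (fun p : ℝ × ℝ => (p.1 + p.2) ^ 2) 2 μ :=
    (memLp_sq_gN v).comp_measurePreserving p1
  have m2 : MemLp (fun p : ℝ × ℝ => p.2 ^ 2) 2 μ :=
    (memLp_sq_gN σ).comp_measurePreserving p2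
  have e1 : ∫ p, (p.1 + p.2) ^ 2 ∂μ = v := by
    rw [← integral_sq_gN hv0.le, ← p1.map_eq, integral_map (by fun_prop) (by fun_prop)]
  have e2 : ∫ p, p.2 ^ 2 ∂μ = σ := by
    rw [← integral_sq_gN hσ.le, ← p2.map_eq, integral_map (by fun_prop) (by fun_prop)]
  have f1 : ∫ p, (p.1 + p.2) ^ 4 ∂μ = K4 * v ^ 2 := by
    rw [← integral_four_gN hv0.le, ← p1.map_eq, integral_map (by fun_prop) (by fun_prop)]
  have f2 : ∫ p, p.2 ^ 4 ∂μ = K4 * σ ^ 2 := by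
    rw [← integral_four_gN hσ.le, ← p2.map_eq, integral_map (by fun_prop) (by fun_prop)]
  have i1 : Integrable (fun p : ℝ × ℝ => (p.1 + p.2) ^ 4) μ :=
    m1.integrable_sq.congr (ae_of_all _ fun x => by simp only; ring)
  have i2 : Integrable (fun p : ℝ × ℝ => p.2 ^ 4) μ :=
    m2.integrable_sq.congr (ae_of_all _ fun x => by simp only; ring)
  have hf : (fun p : ℝ × ℝ => idt σ v p.1 (p.1 + p.2)) = fun p =>
      1 / 2 * Real.log (v / σ) +
        ((2 * v)⁻¹ * (p.1 + p.2) ^ 2 - (2 * σ)⁻¹ * p.2 ^ 2) := by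
    ext p
    simp only [idt, div_eq_inv_mul]
    ring
  have mg : MemLp (fun p : ℝ × ℝ => (2 * v)⁻¹ * (p.1 + p.2) ^ 2 - (2 * σ)⁻¹ * p.2 ^ 2) 2 μ :=
    (m1.const_mul _).sub (m2.const_mul _)
  rw [hf]
  have mc : MemLp (fun _ : ℝ × ℝ => 1 / 2 * Real.log (v / σ)) 2 μ := memLp_const _
  refine ⟨MemLp.add mc mg, ?_, ?_⟩
  · rw [integral_add (integrable_const _) (mg.integrable (by norm_num)), integral_const,
      integral_sub ((m1.integrable (by norm_num)).const_mul _)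
        ((m2.integrable (by norm_num)).const_mul _),
      integral_const_mul, integral_const_mul, e1, e2]
    simp
    field_simp
    ring
  · rw [variance_const_add mg.aestronglyMeasurable]
    refine (variance_le_expectation_sq mg.aestronglyMeasurable).trans ?_
    have hb : ∫ p, (2 * (2 * v)⁻¹ ^ 2 * (p.1 + p.2) ^ 4 + 2 * (2 * σ)⁻¹ ^ 2 * p.2 ^ 4) ∂μ =
        K4 := by
      rw [integral_add (i1.const_mul _) (i2.const_mul _), integral_const_mul,
        integral_const_mul, f1, f2]
      field_simp
      ring
    rw [← hb]
    refine integral_mono mg.integrable_sq ((i1.const_mul _).add (i2.const_mul _)) fun p => ?_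
    simp only [Pi.pow_apply, Pi.add_apply]
    nlinarith [sq_nonneg ((2 * v)⁻¹ * (p.1 + p.2) ^ 2 + (2 * σ)⁻¹ * p.2 ^ 2)]

/-- the information density for a fixed input: moments -/
lemma fixed_moments {σ v : ℝ} (hσ : 0 < σ) (hv : σ ≤ v) (x : ℝ) :
    MemLp (fun w : ℝ => idt σ v x (x + w)) 2 (gN σ) ∧
    ∫ w, idt σ v x (x + w) ∂(gN σ) =
      1 / 2 * Real.log (v / σ) + (x ^ 2 - (v - σ)) / (2 * v) ∧
    Var[fun w : ℝ => idt σ v x (x + w); gN σ] ≤ K4 + 2 * (x ^ 2 / v) := by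
  have hv0 : 0 < v := by linarith
  set μ := gN σ
  have m2 : MemLp (fun w : ℝ => w ^ 2) 2 μ := memLp_sq_gN σ
  have m1 : MemLp (fun w : ℝ => w) 2 μ := memLp_id_gN σ
  have hf : (fun w : ℝ => idt σ v x (x + w)) = fun w =>
      (1 / 2 * Real.log (v / σ) + (2 * v)⁻¹ * x ^ 2) +
        (((2 * v)⁻¹ - (2 * σ)⁻¹) * w ^ 2 + (x / v) * w) := by
    ext p
    simp only [idt]
    field_simp
    ring
  have mg : MemLp (fun w : ℝ => ((2 * v)⁻¹ - (2 * σ)⁻¹) * w ^ 2 + (x / v) * w) 2 μ :=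
    (m2.const_mul _).add (m1.const_mul _)
  have i4 := integrable_four_gN σ
  rw [hf]
  have mc : MemLp (fun _ : ℝ => 1 / 2 * Real.log (v / σ) + (2 * v)⁻¹ * x ^ 2) 2 μ :=
    memLp_const _
  refine ⟨MemLp.add mc mg, ?_, ?_⟩
  · rw [integral_add (integrable_const _) (mg.integrable (by norm_num)), integral_const,
      integral_add ((m2.integrable (by norm_num)).const_mul _)
        ((m1.integrable (by norm_num)).const_mul _),
      integral_const_mul, integral_const_mul, integral_sq_gN hσ.le, integral_id_gN]
    simp
    field_simp
    ring
  · rw [variance_const_add mg.aestronglyMeasurable]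
    refine (variance_le_expectation_sq mg.aestronglyMeasurable).trans ?_
    have i2 : Integrable (fun w : ℝ => w ^ 2) μ := m2.integrable (by norm_num)
    have hb : ∫ w, (2 * ((2 * v)⁻¹ - (2 * σ)⁻¹) ^ 2 * w ^ 4 + 2 * (x / v) ^ 2 * w ^ 2) ∂μ =
        2 * ((2 * v)⁻¹ - (2 * σ)⁻¹) ^ 2 * (K4 * σ ^ 2) + 2 * (x / v) ^ 2 * σ := by
      rw [integral_add (i4.const_mul _) (i2.const_mul _), integral_const_mul,
        integral_const_mul, integral_four_gN hσ.le, integral_sq_gN hσ.le]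
    refine le_trans (integral_mono mg.integrable_sq ((i4.const_mul _).add (i2.const_mul _))
      fun w => ?_) (hb.le.trans ?_)
    · simp only [Pi.pow_apply, Pi.add_apply]
      nlinarith [sq_nonneg (((2 * v)⁻¹ - (2 * σ)⁻¹) * w ^ 2 - (x / v) * w)]
    · have h1 : 2 * ((2 * v)⁻¹ - (2 * σ)⁻¹) ^ 2 * (K4 * σ ^ 2) ≤ K4 := by
        have : 2 * ((2 * v)⁻¹ - (2 * σ)⁻¹) ^ 2 * (K4 * σ ^ 2) = K4 * ((1 - σ / v) ^ 2 / 2) := by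
          field_simp
          ring
        rw [this]
        have h0 : 0 ≤ σ / v := by positivity
        have h2 : σ / v ≤ 1 := (div_le_one hv0).2 hv
        have : (1 - σ / v) ^ 2 / 2 ≤ 1 := by nlinarith
        nlinarith [K4_nonneg]
      have h2 : 2 * (x / v) ^ 2 * σ ≤ 2 * (x ^ 2 / v) := by
        have : 2 * (x / v) ^ 2 * σ = 2 * (x ^ 2 / v) * (σ / v) := by field_simp
        rw [this]
        have h2 : σ / v ≤ 1 := (div_le_one hv0).2 hv
        exact mul_le_of_le_one_right (by positivity) h2
      linarith

lemma sq_moments {s : ℝ} (hs : 0 ≤ s) :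
    Var[fun x : ℝ => x ^ 2; gN s] ≤ K4 * s ^ 2 := by
  refine (variance_le_expectation_sq (memLp_sq_gN s).aestronglyMeasurable).trans ?_
  rw [← integral_four_gN hs]
  refine le_of_eq (integral_congr_ae (ae_of_all _ fun x => ?_))
  simp only [Pi.pow_apply]; ring

lemma prod_pi_eq {l : ℕ} (s σ : Fin l → ℝ) (A : Set ((Fin l → ℝ) × (Fin l → ℝ))) :
    ((Measure.pi fun i => gN (s i)).prod (Measure.pi fun i => gN (σ i))) A =
      (Measure.pi fun i => (gN (s i)).prod (gN (σ i)))
        {q | ((fun i => (q i).1), (fun i => (q i).2)) ∈ A} := by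
  rw [← (measurePreserving_arrowProdEquivProdArrow ℝ ℝ (Fin l) (fun i => gN (s i))
    (fun i => gN (σ i))).measure_preimage_equiv]
  rfl

lemma idens_cheb {l : ℕ} {s σ : Fin l → ℝ} (hs : ∀ i, 0 ≤ s i) (hσ : ∀ i, 0 < σ i) {c : ℝ}
    (hc : 0 < c) :
    ((Measure.pi fun i => gN (s i)).prod (Measure.pi fun i => gN (σ i)))
      {q | c ≤ |idens σ (fun i => s i + σ i) q.1 (fun i => q.1 i + q.2 i) -
        ∑ i, 1 / 2 * Real.log ((s i + σ i) / σ i)|} ≤ ENNReal.ofReal (l * K4 / c ^ 2) := by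
  rw [prod_pi_eq]
  have := cheb_pi (fun i => (gN (s i)).prod (gN (σ i)))
    (fun i p => idt (σ i) (s i + σ i) p.1 (p.1 + p.2)) (fun i => (pair_moments (hs i) (hσ i)).1)
    (fun _ => K4) (fun i => (pair_moments (hs i) (hσ i)).2.2) hc
  simp only [fun i => (pair_moments (hs i) (hσ i)).2.1, Finset.sum_const, Finset.card_univ,
    Fintype.card_fin, nsmul_eq_mul] at this
  exact this

lemma power_cheb {l : ℕ} {s : Fin l → ℝ} (hs : ∀ i, 0 ≤ s i) {S : ℝ} (hS : ∀ i, s i ≤ S) {c : ℝ}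
    (hc : 0 < c) :
    (Measure.pi fun i => gN (s i)) {x | c ≤ |∑ i, x i ^ 2 - ∑ i, s i|} ≤
      ENNReal.ofReal (l * (K4 * S ^ 2) / c ^ 2) := by
  have := cheb_pi (fun i => gN (s i)) (fun i x => x ^ 2) (fun i => memLp_sq_gN (s i))
    (fun _ => K4 * S ^ 2) (fun i => (sq_moments (hs i)).trans ?_) hc
  · simp only [fun i => integral_sq_gN (hs i), Finset.sum_const, Finset.card_univ,
      Fintype.card_fin, nsmul_eq_mul] at this
    exact this
  · have := hs i
    have := hS i
    have := K4_nonneg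
    gcongr

lemma fixed_cheb {l : ℕ} {σ v : Fin l → ℝ} (hσ : ∀ i, 0 < σ i) (hv : ∀ i, σ i ≤ v i)
    (x : Fin l → ℝ) {c : ℝ} (hc : 0 < c) :
    (Measure.pi fun i => gN (σ i))
      {w | c ≤ |idens σ v x (fun i => x i + w i) -
        ∑ i, (1 / 2 * Real.log (v i / σ i) + (x i ^ 2 - (v i - σ i)) / (2 * v i))|} ≤
      ENNReal.ofReal ((∑ i, (K4 + 2 * (x i ^ 2 / v i))) / c ^ 2) := by
  have := cheb_pi (fun i => gN (σ i))
    (fun i w => idt (σ i) (v i) (x i) (x i + w)) (fun i => (fixed_moments (hσ i) (hv i) (x i)).1)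
    _ (fun i => (fixed_moments (hσ i) (hv i) (x i)).2.2) hc
  simp only [fun i => (fixed_moments (hσ i) (hv i) (x i)).2.1] at this
  exact this

/-! ### Converse -/

lemma conv_block {l M : ℕ} (hl : 0 < l) {σ2 : ℕ → ℝ} (hσ : ∀ i, 0 < σ2 i) {ν P δ : ℝ}
    (hν : 0 < ν) (hP : 0 < P) (hδ : 0 < δ) (enc : Fin M → Fin l → ℝ)
    (dec : (Fin l → ℝ) → Fin M) (hpow : ∀ u, powerConstraint P l (enc u)) :
    1 - avgError σ2 l M enc dec ≤ (K4 + 2 * P / ν) / (l * δ ^ 2) +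
      Real.exp (∑ i ∈ Finset.range l, 1 / 2 * Real.log (max ν (σ2 i) / σ2 i) +
        (l * P - ∑ i ∈ Finset.range l, (max ν (σ2 i) - σ2 i)) / (2 * ν) + l * δ) / M := by
  have hl' : (0 : ℝ) < l := by exact_mod_cast hl
  have hM : 0 < M := (dec 0).pos
  have hM' : (0 : ℝ) < M := by exact_mod_cast hM
  set σ : Fin l → ℝ := fun i => σ2 i with hσd
  set v : Fin l → ℝ := fun i => max ν (σ2 i) with hvd
  have hσ' : ∀ i, 0 < σ i := fun i => hσ i
  have hv' : ∀ i, 0 < v i := fun i => lt_max_of_lt_left hν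
  have hσv : ∀ i, σ i ≤ v i := fun i => le_max_right _ _
  set G := ∑ i ∈ Finset.range l, 1 / 2 * Real.log (max ν (σ2 i) / σ2 i) with hG
  set S := ∑ i ∈ Finset.range l, (max ν (σ2 i) - σ2 i) with hS
  set γ := G + (l * P - S) / (2 * ν) + l * δ with hγ
  set N := noiseMeasure σ2 l with hN
  have hN' : N = Measure.pi fun i => gN (σ i) := rfl
  have : IsProbabilityMeasure N := by rw [hN']; infer_instance
  set Q := Measure.pi fun i => gN (v i) with hQ
  have hpw : ∀ u, ∑ i, enc u i ^ 2 ≤ l * P := by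
    intro u
    have := hpow u
    unfold powerConstraint at this
    rw [one_div, inv_mul_le_iff₀ hl'] at this
    exact this
  -- tail bound
  have htail : ∀ u, (N {w | γ < idens σ v (enc u) (fun i => enc u i + w i)}).toReal ≤
      (K4 + 2 * P / ν) / (l * δ ^ 2) := by
    intro u
    have hmean : ∑ i, (1 / 2 * Real.log (v i / σ i) + (enc u i ^ 2 - (v i - σ i)) / (2 * v i)) ≤
        G + (l * P - S) / (2 * ν) := by
      have h1 : ∀ i : Fin l, (enc u i ^ 2 - (v i - σ i)) / (2 * v i) ≤
          (enc u i ^ 2 - (v i - σ i)) / (2 * ν) := by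
        intro i
        rcases le_total ν (σ2 i) with h | h
        · have : v i - σ i = 0 := by simp [hvd, hσd, h]
          rw [this, sub_zero]
          have : ν ≤ v i := le_max_left _ _
          gcongr
        · have : v i = ν := by simp [hvd, h]
          rw [this]
      have hSS : S = ∑ i, (v i - σ i) := by
        rw [hS, Finset.sum_range]
      have hGG : G = ∑ i, 1 / 2 * Real.log (v i / σ i) := by
        rw [hG, Finset.sum_range]
      rw [Finset.sum_add_distrib, ← hGG]
      gcongr
      calc _ ≤ ∑ i, (enc u i ^ 2 - (v i - σ i)) / (2 * ν) := Finset.sum_le_sum fun i _ => h1 i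
        _ = (∑ i, enc u i ^ 2 - S) / (2 * ν) := by
            rw [← Finset.sum_div, Finset.sum_sub_distrib, hSS]
        _ ≤ _ := by
            have := hpw u
            gcongr
    have hc : 0 < l * δ := by positivity
    have hch := fixed_cheb hσ' hσv (enc u) hc
    have hle : N {w | γ < idens σ v (enc u) (fun i => enc u i + w i)} ≤
        ENNReal.ofReal ((∑ i, (K4 + 2 * (enc u i ^ 2 / v i))) / (l * δ) ^ 2) := by
      refine le_trans (measure_mono ?_) hch
      intro w hw
      simp only [Set.mem_ofPred_eq] at hw ⊢
      refine le_trans ?_ (le_abs_self _)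
      linarith
    have hnn : 0 ≤ (∑ i, (K4 + 2 * (enc u i ^ 2 / v i))) / (l * δ) ^ 2 := by
      refine div_nonneg (Finset.sum_nonneg fun i _ => ?_) (by positivity)
      have := K4_nonneg
      have := hv' i
      positivity
    refine (ENNReal.toReal_le_of_le_ofReal hnn hle).trans ?_
    have h2 : ∑ i, (K4 + 2 * (enc u i ^ 2 / v i)) ≤ l * (K4 + 2 * P / ν) := by
      rw [Finset.sum_add_distrib, Finset.sum_const, Finset.card_univ, Fintype.card_fin,
        nsmul_eq_mul, mul_add]
      gcongr
      calc _ ≤ ∑ i, 2 / ν * enc u i ^ 2 := by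
            refine Finset.sum_le_sum fun i _ => ?_
            have : ν ≤ v i := le_max_left _ _
            rw [div_mul_eq_mul_div, mul_div_assoc]
            gcongr
        _ = 2 / ν * ∑ i, enc u i ^ 2 := by rw [Finset.mul_sum]
        _ ≤ 2 / ν * (l * P) := by
            have := hpw u
            gcongr
        _ = _ := by ring
    calc _ ≤ (l * (K4 + 2 * P / ν)) / (l * δ) ^ 2 := by gcongr
      _ = _ := by field_simp
  -- decoding regions
  set E : Fin M → Set (Fin l → ℝ) := fun u => {w | dec (fun i => enc u i + w i) ≠ u} with hE
  set A : Fin M → Set (Fin l → ℝ) := fun u =>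
    {y | (fun i => y i - enc u i) ∉ toMeasurable N (E u)} with hA
  have hAm : ∀ u, MeasurableSet (A u) := by
    intro u
    have : Measurable (fun (y : Fin l → ℝ) i => y i - enc u i) := by fun_prop
    exact this (measurableSet_toMeasurable N (E u)).compl
  have hAD : ∀ u, ∀ y ∈ A u, dec y = u := by
    intro u y hy
    by_contra hne
    refine hy (subset_toMeasurable N (E u) ?_)
    simpa [hE] using hne
  have hdisj : Pairwise (Function.onFun Disjoint A) := by
    intro u u' huu'
    rw [Function.onFun, Set.disjoint_left]
    intro y hy hy'
    exact huu' ((hAD u y hy).symm.trans (hAD u' y hy'))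
  have hsum : ∑ u, (Q (A u)).toReal ≤ 1 := by
    rw [← ENNReal.toReal_sum (fun u _ => measure_ne_top _ _)]
    have : ∑ u, Q (A u) = Q (⋃ u, A u) := by
      rw [measure_iUnion hdisj hAm, tsum_fintype]
    rw [this]
    exact ENNReal.toReal_le_of_le_ofReal zero_le_one (by simpa using prob_le_one)
  have hone : ∀ u, 1 - (N (E u)).toReal ≤ (K4 + 2 * P / ν) / (l * δ ^ 2) +
      Real.exp γ * (Q (A u)).toReal := by
    intro u
    have h1 := channel_conv_bound hσ' hv' (enc u) γ (hAm u)
    have h2 : {w | (fun i => enc u i + w i) ∈ A u} = (toMeasurable N (E u))ᶜ := by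
      ext w; simp [hA]
    rw [h2, ← hN', ← hQ] at h1
    have h3 := ENNReal.toReal_mono (by finiteness) h1
    rw [ENNReal.toReal_add (by finiteness) (by finiteness), ENNReal.toReal_mul,
      ENNReal.toReal_ofReal (Real.exp_pos _).le,
      prob_compl_eq_one_sub (measurableSet_toMeasurable _ _), measure_toMeasurable,
      ENNReal.toReal_sub_of_le prob_le_one (by simp), ENNReal.toReal_one] at h3
    linarith [htail u]
  have hav : avgError σ2 l M enc dec = (1 / (M : ℝ)) * ∑ u, (N (E u)).toReal := rfl
  have hs := Finset.sum_le_sum fun u (_ : u ∈ Finset.univ) => hone u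
  rw [Finset.sum_sub_distrib, Finset.sum_add_distrib, ← Finset.mul_sum] at hs
  simp only [Finset.sum_const, Finset.card_univ, Fintype.card_fin, nsmul_eq_mul, mul_one] at hs
  rw [hav]
  have h5 : (M : ℝ) - ∑ u, (N (E u)).toReal ≤
      M * ((K4 + 2 * P / ν) / (l * δ ^ 2)) + Real.exp γ := by
    have : Real.exp γ * ∑ u, (Q (A u)).toReal ≤ Real.exp γ :=
      mul_le_of_le_one_right (Real.exp_pos _).le hsum
    linarith
  calc 1 - 1 / (M : ℝ) * ∑ u, (N (E u)).toReal = ((M : ℝ) - ∑ u, (N (E u)).toReal) / M := by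
        field_simp
    _ ≤ (M * ((K4 + 2 * P / ν) / (l * δ ^ 2)) + Real.exp γ) / M := by gcongr
    _ = _ := by rw [add_div, mul_div_cancel_left₀ _ hM'.ne']

lemma converse {σ2 : ℕ → ℝ} (hσ : ∀ i, 0 < σ2 i) {ν P G S R : ℝ} (hν : 0 < ν) (hP : 0 < P)
    (hG : ∀ᶠ l : ℕ in atTop,
      ∑ i ∈ Finset.range l, 1 / 2 * Real.log (max ν (σ2 i) / σ2 i) ≤ l * G)
    (hS : ∀ᶠ l : ℕ in atTop, l * S ≤ ∑ i ∈ Finset.range l, (max ν (σ2 i) - σ2 i))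
    (hR : IsAchievableRate σ2 P R) : R * Real.log 2 ≤ G + (P - S) / (2 * ν) := by
  by_contra! hcon
  have hlog2 : 0 < Real.log 2 := Real.log_pos (by norm_num)
  obtain ⟨δ, hδ⟩ : ∃ δ, δ = (R * Real.log 2 - (G + (P - S) / (2 * ν))) / 4 := ⟨_, rfl⟩
  have hδ0 : 0 < δ := by rw [hδ]; linarith
  obtain ⟨l₀, hl₀⟩ := hR (1 / 2) (by norm_num) (δ / Real.log 2) (by positivity)
  have hlim : Tendsto (fun l : ℕ => (K4 + 2 * P / ν) / ((l : ℝ) * δ ^ 2) +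
      Real.exp (-((l : ℝ) * (2 * δ)))) atTop (𝓝 0) := by
    rw [show (0 : ℝ) = 0 + 0 by simp]
    refine Tendsto.add ?_ ?_
    · refine Tendsto.div_atTop tendsto_const_nhds ?_
      exact tendsto_natCast_atTop_atTop.atTop_mul_const (by positivity)
    · refine Real.tendsto_exp_neg_atTop_nhds_zero.comp ?_
      exact tendsto_natCast_atTop_atTop.atTop_mul_const (by positivity)
  have hev := hlim.eventually (gt_mem_nhds (show (0 : ℝ) < 1 / 2 by norm_num))
  obtain ⟨l, hl, hGl, hSl, hll, hpos⟩ := (hev.and (hG.and (hS.and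
    ((eventually_gt_atTop l₀).and (eventually_gt_atTop 0))))).exists
  obtain ⟨M, enc, dec, hpow, herr, hrate⟩ := hl₀ l hll
  have hl' : (0 : ℝ) < l := by exact_mod_cast hpos
  have hM : 0 < M := (dec 0).pos
  have hM' : (0 : ℝ) < M := by exact_mod_cast hM
  have hb := conv_block hpos hσ hν hP hδ0 enc dec hpow
  have hlogM : l * (R * Real.log 2 - δ) ≤ Real.log M := by
    rw [Real.logb, ge_iff_le, le_div_iff₀ hl', le_div_iff₀ hlog2] at hrate
    calc _ = (R - δ / Real.log 2) * l * Real.log 2 := by field_simp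
      _ ≤ _ := hrate
  have hexp : Real.exp (∑ i ∈ Finset.range l, 1 / 2 * Real.log (max ν (σ2 i) / σ2 i) +
        (l * P - ∑ i ∈ Finset.range l, (max ν (σ2 i) - σ2 i)) / (2 * ν) + l * δ) / M ≤
      Real.exp (-(l * (2 * δ))) := by
    rw [div_le_iff₀ hM']
    conv_rhs => rw [← Real.exp_log hM', ← Real.exp_add]
    apply Real.exp_le_exp.2
    have h1 : (l * P - ∑ i ∈ Finset.range l, (max ν (σ2 i) - σ2 i)) / (2 * ν) ≤
        l * ((P - S) / (2 * ν)) := by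
      rw [← mul_div_assoc]
      gcongr
      linarith
    have h2 : R * Real.log 2 = 4 * δ + (G + (P - S) / (2 * ν)) := by rw [hδ]; ring
    rw [h2] at hlogM
    nlinarith
  linarith

/-! ### Achievability -/

lemma output_law {l : ℕ} {s σ : Fin l → ℝ} (hs : ∀ i, 0 ≤ s i) (hσ : ∀ i, 0 < σ i)
    {U : Set (Fin l → ℝ)} (hU : MeasurableSet U) :
    ((Measure.pi fun i => gN (s i)).prod (Measure.pi fun i => gN (σ i)))
      {q | (fun i => q.1 i + q.2 i) ∈ U} = (Measure.pi fun i => gN (s i + σ i)) U := by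
  rw [prod_pi_eq]
  have h : ∀ i, ((gN (s i)).prod (gN (σ i))).map (fun p => p.1 + p.2) = gN (s i + σ i) :=
    fun i => (conv_gN (hs i) (hσ i).le).map_eq
  have hsf : ∀ i, SigmaFinite (((gN (s i)).prod (gN (σ i))).map (fun p => p.1 + p.2)) := by
    intro i; rw [h i]; infer_instance
  have := Measure.pi_map_pi (μ := fun i => (gN (s i)).prod (gN (σ i)))
    (f := fun (_ : Fin l) (p : ℝ × ℝ) => p.1 + p.2) (fun i => by fun_prop)
  rw [funext h] at this
  rw [← this, Measure.map_apply (by fun_prop) hU]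
  rfl

lemma feinstein {l M : ℕ} {s σ : Fin l → ℝ} (hs : ∀ i, 0 ≤ s i) (hσ : ∀ i, 0 < σ i)
    {F : Set (Fin l → ℝ)} (hF : MeasurableSet F) (γ : ℝ) {η : ℝ≥0∞} (hη : η ≤ 1)
    (h : ((Measure.pi fun i => gN (s i)).prod (Measure.pi fun i => gN (σ i)))
        {q | idens σ (fun i => s i + σ i) q.1 (fun i => q.1 i + q.2 i) ≤ γ} +
      (Measure.pi fun i => gN (s i)) Fᶜ + M * ENNReal.ofReal (Real.exp (-γ)) < η) (k : ℕ)
    (hk : k ≤ M) :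
    ∃ x : ℕ → Fin l → ℝ, ∀ u < k, x u ∈ F ∧ (Measure.pi fun i => gN (σ i))
      {w | ¬ (γ < idens σ (fun i => s i + σ i) (x u) (fun i => x u i + w i) ∧
        ∀ j < u, ¬ γ < idens σ (fun i => s i + σ i) (x j) (fun i => x u i + w i))} ≤ η := by
  induction k with
  | zero => exact ⟨fun _ => 0, fun u hu => absurd hu (Nat.not_lt_zero u)⟩
  | succ k ih =>
    obtain ⟨x, hx⟩ := ih (by omega)
    set v : Fin l → ℝ := fun i => s i + σ i with hv
    have hv' : ∀ i, 0 < v i := fun i => by have := hs i; have := hσ i; simp only [hv]; linarith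
    set N := Measure.pi fun i => gN (σ i) with hN
    set p := Measure.pi fun i => gN (s i) with hp
    obtain ⟨z, hz, hz'⟩ : ∃ z ∈ F, N {w | ¬ (γ < idens σ v z (fun i => z i + w i) ∧
        ∀ j < k, ¬ γ < idens σ v (x j) (fun i => z i + w i))} ≤ η := by
      by_contra! hcon
      set U : Set (Fin l → ℝ) := ⋃ j ∈ Finset.range k, {y | γ < idens σ v (x j) y} with hU
      have hUm : MeasurableSet U := Finset.measurableSet_biUnion _ fun j _ =>
        measurableSet_lt measurable_const (measurable_idens_right σ v (x j))
      have hQU : (Measure.pi fun i => gN (v i)) U ≤ M * ENNReal.ofReal (Real.exp (-γ)) := by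
        refine (measure_biUnion_finset_le _ _).trans ?_
        refine (Finset.sum_le_sum fun j _ => channel_ach_bound hσ hv' (x j) γ).trans ?_
        rw [Finset.sum_const, Finset.card_range, nsmul_eq_mul]
        gcongr
        omega
      set B : Set ((Fin l → ℝ) × (Fin l → ℝ)) :=
        {q | idens σ v q.1 (fun i => q.1 i + q.2 i) ≤ γ} ∪ {q | (fun i => q.1 i + q.2 i) ∈ U}
        with hB
      have hmI : Measurable (fun q : (Fin l → ℝ) × (Fin l → ℝ) =>
          idens σ v q.1 (fun i => q.1 i + q.2 i)) :=
        (measurable_idens σ v).comp (f := fun q : (Fin l → ℝ) × (Fin l → ℝ) =>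
          (q.1, fun i => q.1 i + q.2 i)) (by fun_prop)
      have hBm : MeasurableSet B := by
        refine (measurableSet_le hmI measurable_const).union ?_
        have : Measurable (fun (q : (Fin l → ℝ) × (Fin l → ℝ)) i => q.1 i + q.2 i) := by fun_prop
        exact this hUm
      have hBup : (p.prod N) B ≤ (p.prod N) {q | idens σ v q.1 (fun i => q.1 i + q.2 i) ≤ γ} +
          M * ENNReal.ofReal (Real.exp (-γ)) := by
        refine (measure_union_le _ _).trans ?_
        rw [output_law hs hσ hUm]
        gcongr
      have hBlow : η * p F ≤ (p.prod N) B := by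
        rw [Measure.prod_apply hBm, ← setLIntegral_const]
        refine le_trans (setLIntegral_mono' hF fun z hz => ?_) (setLIntegral_le_lintegral F _)
        refine (hcon z hz).le.trans (measure_mono ?_)
        intro w hw
        have hw : γ < idens σ v z (fun i => z i + w i) →
          ∃ j < k, γ < idens σ v (x j) (fun i => z i + w i) := hw
        by_cases h0 : γ < idens σ v z (fun i => z i + w i)
        swap
        · exact Or.inl (not_lt.1 h0)
        · obtain ⟨j, hj, hw⟩ := hw h0
          refine Or.inr ?_
          simp only [Set.mem_ofPred_eq, hU, Set.mem_iUnion]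
          exact ⟨j, Finset.mem_range.2 hj, hw⟩
      have h1 : η ≤ η * p F + p Fᶜ := by
        calc η = η * (p F + p Fᶜ) := by rw [measure_add_measure_compl hF, measure_univ, mul_one]
          _ = η * p F + η * p Fᶜ := mul_add _ _ _
          _ ≤ _ := by
            gcongr
            exact mul_le_of_le_one_left (zero_le) hη
      refine absurd h (not_lt.2 (h1.trans ?_))
      calc _ ≤ ((p.prod N) {q | idens σ v q.1 (fun i => q.1 i + q.2 i) ≤ γ} +
          M * ENNReal.ofReal (Real.exp (-γ))) + p Fᶜ := by gcongr; exact hBlow.trans hBup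
        _ = _ := by ring
    refine ⟨Function.update x k z, fun u hu => ?_⟩
    rcases Nat.lt_succ_iff_lt_or_eq.1 hu with h1 | h1
    · have e : ∀ j ≤ u, Function.update x k z j = x j := fun j hj =>
        Function.update_of_ne (by omega) _ _
      rw [e u le_rfl]
      refine ⟨(hx u h1).1, le_trans (measure_mono ?_) (hx u h1).2⟩
      intro w hw hw'
      exact hw ⟨hw'.1, fun j hj => by rw [e j hj.le]; exact hw'.2 j hj⟩
    · subst h1
      have e : ∀ j < u, Function.update x u z j = x j := fun j hj =>
        Function.update_of_ne (by omega) _ _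
      rw [Function.update_self]
      refine ⟨hz, le_trans (measure_mono ?_) hz'⟩
      intro w hw hw'
      exact hw ⟨hw'.1, fun j hj => by rw [e j hj]; exact hw'.2 j hj⟩

open Classical in
lemma code_exists {l M : ℕ} (hM : 0 < M) {s : Fin l → ℝ} {σ2 : ℕ → ℝ}
    (hs : ∀ i, 0 ≤ s i) (hσ : ∀ i, 0 < σ2 i) {P : ℝ} (γ : ℝ) {η : ℝ} (hη0 : 0 ≤ η) (hη : η ≤ 1)
    (h : ((Measure.pi fun i => gN (s i)).prod (Measure.pi fun i : Fin l => gN (σ2 i)))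
        {q | idens (fun i => σ2 i) (fun i => s i + σ2 i) q.1 (fun i => q.1 i + q.2 i) ≤ γ} +
      (Measure.pi fun i => gN (s i)) {x | powerConstraint P l x}ᶜ +
        M * ENNReal.ofReal (Real.exp (-γ)) < ENNReal.ofReal η) :
    ∃ (enc : Fin M → Fin l → ℝ) (dec : (Fin l → ℝ) → Fin M),
      (∀ u, powerConstraint P l (enc u)) ∧ avgError σ2 l M enc dec ≤ η := by
  have hF : MeasurableSet {x : Fin l → ℝ | powerConstraint P l x} := by
    unfold powerConstraint
    exact measurableSet_le (by fun_prop) measurable_const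
  obtain ⟨x, hx⟩ := feinstein hs (fun i : Fin l => hσ i) hF γ (by simpa using hη) h M le_rfl
  set v : Fin l → ℝ := fun i => s i + σ2 i with hv
  set σ : Fin l → ℝ := fun i => σ2 i with hσd
  refine ⟨fun u => x u, fun y => if hy : ∃ u : ℕ, u < M ∧ γ < idens σ v (x u) y
    then ⟨Nat.find hy, (Nat.find_spec hy).1⟩ else ⟨0, hM⟩, fun u => (hx u u.2).1, ?_⟩
  have hM' : (0 : ℝ) < M := by exact_mod_cast hM
  unfold avgError
  rw [one_div, inv_mul_le_iff₀ hM']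
  refine (Finset.sum_le_card_nsmul _ _ η fun u _ => ?_).trans (by simp)
  refine ENNReal.toReal_le_of_le_ofReal hη0 (le_trans (measure_mono ?_) (hx u u.2).2)
  intro w hw hw'
  refine hw ?_
  have hex : ∃ u' : ℕ, u' < M ∧ γ < idens σ v (x u') (fun i => x u i + w i) := ⟨u, u.2, hw'.1⟩
  refine (dif_pos hex).trans ?_
  apply Fin.ext
  simp only
  rw [Nat.find_eq_iff]
  exact ⟨⟨u.2, hw'.1⟩, fun j hj hj' => hw'.2 j hj hj'.2⟩

lemma achievability {s σ2 : ℕ → ℝ} {S P P' R : ℝ} (hs : ∀ i, 0 ≤ s i) (hS : ∀ i, s i ≤ S)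
    (hσ : ∀ i, 0 < σ2 i) (hPP : P' < P) (hR : 0 < R)
    (hpow : ∀ᶠ l : ℕ in atTop, ∑ i ∈ Finset.range l, s i ≤ l * P')
    (hrate : ∀ δ > 0, ∀ᶠ l : ℕ in atTop,
      l * (R * Real.log 2 - δ) ≤
        ∑ i ∈ Finset.range l, 1 / 2 * Real.log ((s i + σ2 i) / σ2 i)) :
    IsAchievableRate σ2 P R := by
  intro η₁ hη₁ η₂' hη₂'
  have hlog2 : 0 < Real.log 2 := Real.log_pos (by norm_num)
  obtain ⟨η₂, hη₂, hle, hleR⟩ : ∃ η₂ > 0, η₂ ≤ η₂' ∧ η₂ ≤ R :=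
    ⟨min η₂' R, lt_min hη₂' hR, min_le_left _ _, min_le_right _ _⟩
  obtain ⟨η, hη, hη1, hηle⟩ : ∃ η > 0, η < η₁ ∧ η ≤ 1 :=
    ⟨min (η₁ / 2) 1, by positivity, (min_le_left _ _).trans_lt (by linarith), min_le_right _ _⟩
  set ρ := R * Real.log 2 with hρ
  set δ := η₂ * Real.log 2 / 4 with hδ
  have hδ0 : 0 < δ := by positivity
  have hρδ : 0 < ρ - 2 * δ := by
    have : η₂ * Real.log 2 ≤ ρ := by rw [hρ]; gcongr
    have : 0 < ρ := by positivity
    rw [hδ]; linarith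
  have hlim : Tendsto (fun l : ℕ => K4 / ((l : ℝ) * δ ^ 2) +
      (K4 * S ^ 2) / ((l : ℝ) * (P - P') ^ 2) +
      (Real.exp (-((l : ℝ) * (2 * δ))) + Real.exp (-((l : ℝ) * (ρ - 2 * δ))))) atTop (𝓝 0) := by
    have hd : 0 < P - P' := by linarith
    rw [show (0 : ℝ) = 0 + 0 + (0 + 0) by simp]
    have ht : ∀ a : ℝ, 0 < a → Tendsto (fun l : ℕ => (l : ℝ) * a) atTop atTop := fun a ha =>
      tendsto_natCast_atTop_atTop.atTop_mul_const ha
    refine ((Tendsto.div_atTop tendsto_const_nhds (ht _ (by positivity))).add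
      (Tendsto.div_atTop tendsto_const_nhds (ht _ (by positivity)))).add (Tendsto.add ?_ ?_)
    · exact Real.tendsto_exp_neg_atTop_nhds_zero.comp (ht _ (by positivity))
    · exact Real.tendsto_exp_neg_atTop_nhds_zero.comp (ht _ hρδ)
  have hev := hlim.eventually (gt_mem_nhds hη)
  have hall := hev.and (hpow.and ((hrate δ hδ0).and (eventually_gt_atTop 0)))
  obtain ⟨l₀, hl₀⟩ := eventually_atTop.1 hall
  refine ⟨l₀, fun l hl => ?_⟩
  obtain ⟨hsmall, hpl, hrl, hpos⟩ := hl₀ l hl.le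
  have hl' : (0 : ℝ) < l := by exact_mod_cast hpos
  set M := ⌈Real.exp (l * (ρ - 4 * δ))⌉₊ with hM
  have hM0 : 0 < M := Nat.ceil_pos.2 (Real.exp_pos _)
  have hM' : (0 : ℝ) < M := by exact_mod_cast hM0
  have hMlow : Real.exp (l * (ρ - 4 * δ)) ≤ M := Nat.le_ceil _
  have hMup : (M : ℝ) ≤ Real.exp (l * (ρ - 4 * δ)) + 1 :=
    (Nat.ceil_lt_add_one (Real.exp_pos _).le).le
  set γ := l * (ρ - 2 * δ) with hγ
  have hmain : ((Measure.pi fun i : Fin l => gN (s i)).prod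
        (Measure.pi fun i : Fin l => gN (σ2 i)))
        {q | idens (fun i => σ2 i) (fun i => s i + σ2 i) q.1 (fun i => q.1 i + q.2 i) ≤ γ} +
      (Measure.pi fun i : Fin l => gN (s i)) {x | powerConstraint P l x}ᶜ +
        M * ENNReal.ofReal (Real.exp (-γ)) < ENNReal.ofReal η := by
    have b1 : ((Measure.pi fun i : Fin l => gN (s i)).prod
        (Measure.pi fun i : Fin l => gN (σ2 i)))
        {q | idens (fun i => σ2 i) (fun i => s i + σ2 i) q.1 (fun i => q.1 i + q.2 i) ≤ γ} ≤
        ENNReal.ofReal (K4 / ((l : ℝ) * δ ^ 2)) := by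
      have hc : 0 < l * δ := by positivity
      have := idens_cheb (fun i : Fin l => hs i) (fun i : Fin l => hσ i) hc
      rw [show (l : ℝ) * K4 / (l * δ) ^ 2 = K4 / ((l : ℝ) * δ ^ 2) by field_simp] at this
      refine le_trans (measure_mono ?_) this
      intro q hq
      simp only [Set.mem_ofPred_eq] at hq ⊢
      rw [Finset.sum_range] at hrl
      refine le_trans ?_ (neg_le_abs _)
      rw [hγ] at hq
      linarith
    have b2 : (Measure.pi fun i : Fin l => gN (s i)) {x | powerConstraint P l x}ᶜ ≤
        ENNReal.ofReal ((K4 * S ^ 2) / ((l : ℝ) * (P - P') ^ 2)) := by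
      have hd : 0 < P - P' := by linarith
      have hc : 0 < l * (P - P') := by positivity
      have := power_cheb (fun i : Fin l => hs i) (fun i : Fin l => hS i) hc
      rw [show (l : ℝ) * (K4 * S ^ 2) / (l * (P - P')) ^ 2 =
        (K4 * S ^ 2) / ((l : ℝ) * (P - P') ^ 2) by field_simp] at this
      refine le_trans (measure_mono ?_) this
      intro q hq
      simp only [Set.mem_compl_iff, Set.mem_ofPred_eq, powerConstraint, one_div,
        inv_mul_le_iff₀ hl', not_le] at hq ⊢
      rw [Finset.sum_range] at hpl
      refine le_trans ?_ (le_abs_self _)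
      linarith
    have b3 : (M : ℝ≥0∞) * ENNReal.ofReal (Real.exp (-γ)) ≤
        ENNReal.ofReal (Real.exp (-((l : ℝ) * (2 * δ))) +
          Real.exp (-((l : ℝ) * (ρ - 2 * δ)))) := by
      rw [← ENNReal.ofReal_natCast, ← ENNReal.ofReal_mul (by positivity)]
      refine ENNReal.ofReal_le_ofReal ?_
      calc (M : ℝ) * Real.exp (-γ) ≤ (Real.exp (l * (ρ - 4 * δ)) + 1) * Real.exp (-γ) := by
            gcongr
        _ = _ := by
            rw [add_mul, ← Real.exp_add, one_mul, hγ]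
            congr 2
            ring
    refine lt_of_le_of_lt (add_le_add (add_le_add b1 b2) b3) ?_
    have := K4_nonneg
    rw [← ENNReal.ofReal_add (by positivity) (by positivity),
      ← ENNReal.ofReal_add (by positivity) (by positivity)]
    exact (ENNReal.ofReal_lt_ofReal_iff hη).2 hsmall
  obtain ⟨enc, dec, h1, h2⟩ := code_exists hM0 (fun i : Fin l => hs i) hσ γ hη.le hηle hmain
  refine ⟨M, enc, dec, h1, h2.trans_lt hη1, ?_⟩
  rw [Real.logb, ge_iff_le, le_div_iff₀ hl', le_div_iff₀ hlog2]
  have h3 : l * (ρ - 4 * δ) ≤ Real.log M := (Real.le_log_iff_exp_le hM').2 hMlow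
  refine le_trans ?_ h3
  have : ρ - 4 * δ = (R - η₂) * Real.log 2 := by rw [hρ, hδ]; ring
  rw [this]
  calc (R - η₂') * l * Real.log 2 ≤ (R - η₂) * l * Real.log 2 := by gcongr
    _ = _ := by ring

/-! ### Equidistribution -/

lemma fourier_mul_coe {T : ℝ} (k : ℤ) (j : ℕ) (a : ℝ) :
    fourier k (((j : ℝ) * a : ℝ) : AddCircle T) = fourier k ((a : ℝ) : AddCircle T) ^ j := by
  rw [fourier_coe_apply, fourier_coe_apply, ← Complex.exp_nat_mul]
  congr 1
  push_cast
  ring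

lemma integral_fourier_ne {T : ℝ} [hT : Fact (0 < T)] {k : ℤ} (hk : k ≠ 0) :
    ∫ x, fourier k x ∂(AddCircle.haarAddCircle (T := T)) = 0 := by
  have h := congrFun (fourierCoeff_fourier (T := T) k) 0
  rw [fourierCoeff, Pi.single_eq_of_ne hk.symm] at h
  simpa using h

lemma equi_fourier {T : ℝ} [hT : Fact (0 < T)] {a : ℕ → ℝ} {θ : ℝ} (ha : Tendsto a atTop (𝓝 θ))
    (hθ : ∀ k : ℤ, k ≠ 0 → fourier k (θ : AddCircle T) ≠ 1) (m : ℕ) (k : ℤ) :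
    ∀ δ > 0, ∀ᶠ n in atTop, ∀ᶠ l : ℕ in atTop,
      ‖∑ i ∈ Finset.range l, fourier k ((((i + m : ℕ) : ℝ) * a n : ℝ) : AddCircle T) -
        l * ∫ x, fourier k x ∂(AddCircle.haarAddCircle (T := T))‖ ≤ l * δ := by
  intro δ hδ
  by_cases hk : k = 0
  · subst hk
    refine Eventually.of_forall fun n => Eventually.of_forall fun l => ?_
    simp
    positivity
  rw [integral_fourier_ne hk]
  have hz : Tendsto (fun n => fourier k ((a n : ℝ) : AddCircle T)) atTop
      (𝓝 (fourier k ((θ : ℝ) : AddCircle T))) := by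
    have : Continuous (fun t : ℝ => fourier k ((t : ℝ) : AddCircle T)) :=
      (fourier k).continuous.comp (AddCircle.continuous_mk' T)
    exact (this.tendsto θ).comp ha
  have hne := hz.eventually_ne (hθ k hk)
  filter_upwards [hne] with n hn
  set z := fourier k ((a n : ℝ) : AddCircle T) with hzd
  have hz1 : ‖z‖ = 1 := by rw [hzd, fourier_apply]; exact Circle.norm_coe _
  have hpos : 0 < ‖z - 1‖ := norm_pos_iff.2 (sub_ne_zero.2 hn)
  have hl : ∀ᶠ l : ℕ in atTop, 2 / ‖z - 1‖ ≤ l * δ :=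
    (tendsto_natCast_atTop_atTop.atTop_mul_const hδ).eventually_ge_atTop _
  filter_upwards [hl] with l hl
  refine le_trans ?_ hl
  have e : ∑ i ∈ Finset.range l, fourier k ((((i + m : ℕ) : ℝ) * a n : ℝ) : AddCircle T) =
      z ^ m * ((z ^ l - 1) / (z - 1)) := by
    rw [← geom_sum_eq hn, Finset.mul_sum]
    refine Finset.sum_congr rfl fun i _ => ?_
    rw [fourier_mul_coe, ← hzd, pow_add, mul_comm]
  rw [e, mul_zero, sub_zero, norm_mul, norm_div, norm_pow, hz1, one_pow, one_mul]
  gcongr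
  calc ‖z ^ l - 1‖ ≤ ‖z ^ l‖ + ‖(1 : ℂ)‖ := norm_sub_le _ _
    _ = 2 := by rw [norm_pow, hz1]; norm_num

lemma cm_integrable {T : ℝ} [hT : Fact (0 < T)] {E : Type*} [NormedAddCommGroup E]
    (h : C(AddCircle T, E)) : Integrable h (AddCircle.haarAddCircle (T := T)) :=
  h.continuous.integrable_of_hasCompactSupport (HasCompactSupport.of_compactSpace _)

lemma equi_complex {T : ℝ} [hT : Fact (0 < T)] {a : ℕ → ℝ} {θ : ℝ} (ha : Tendsto a atTop (𝓝 θ))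
    (hθ : ∀ k : ℤ, k ≠ 0 → fourier k (θ : AddCircle T) ≠ 1) (m : ℕ) (h : C(AddCircle T, ℂ)) :
    ∀ δ > 0, ∀ᶠ n in atTop, ∀ᶠ l : ℕ in atTop,
      ‖∑ i ∈ Finset.range l, h ((((i + m : ℕ) : ℝ) * a n : ℝ) : AddCircle T) -
        l * ∫ x, h x ∂(AddCircle.haarAddCircle (T := T))‖ ≤ l * δ := by
  have hspan : ∀ g ∈ Submodule.span ℂ (Set.range (@fourier T)), ∀ δ > 0, ∀ᶠ n in atTop,
      ∀ᶠ l : ℕ in atTop,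
      ‖∑ i ∈ Finset.range l, g ((((i + m : ℕ) : ℝ) * a n : ℝ) : AddCircle T) -
        l * ∫ x, g x ∂(AddCircle.haarAddCircle (T := T))‖ ≤ l * δ := by
    intro g hg
    induction hg using Submodule.span_induction with
    | mem x hx =>
      obtain ⟨k, rfl⟩ := hx
      exact equi_fourier ha hθ m k
    | zero =>
      intro δ hδ
      refine Eventually.of_forall fun n => Eventually.of_forall fun l => ?_
      simp
      positivity
    | add x y _ _ hx hy =>
      intro δ hδ
      filter_upwards [hx (δ / 2) (by positivity), hy (δ / 2) (by positivity)] with n h1 h2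
      filter_upwards [h1, h2] with l h1 h2
      simp only [ContinuousMap.add_apply]
      rw [integral_add (cm_integrable x) (cm_integrable y), Finset.sum_add_distrib, mul_add,
        add_sub_add_comm]
      refine (norm_add_le _ _).trans ?_
      linarith
    | smul c x _ hx =>
      intro δ hδ
      filter_upwards [hx (δ / (‖c‖ + 1)) (by positivity)] with n h1
      filter_upwards [h1] with l h1
      simp only [ContinuousMap.smul_apply, smul_eq_mul]
      rw [integral_const_mul, ← Finset.mul_sum, mul_left_comm, ← mul_sub, norm_mul]
      calc ‖c‖ * _ ≤ ‖c‖ * (l * (δ / (‖c‖ + 1))) := by gcongr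
        _ = l * δ * (‖c‖ / (‖c‖ + 1)) := by ring
        _ ≤ l * δ * 1 := by
            gcongr
            rw [div_le_one (by positivity)]
            linarith
        _ = _ := mul_one _
  intro δ hδ
  have hcl : h ∈ closure (Submodule.span ℂ (Set.range (@fourier T)) : Set C(AddCircle T, ℂ)) := by
    rw [← Submodule.topologicalClosure_coe, span_fourier_closure_eq_top]
    trivial
  obtain ⟨g, hg, hgd⟩ := Metric.mem_closure_iff.1 hcl (δ / 3) (by positivity)
  rw [dist_eq_norm] at hgd
  filter_upwards [hspan g hg (δ / 3) (by positivity)] with n h1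
  filter_upwards [h1] with l h1
  have hpt : ∀ x, ‖h x - g x‖ ≤ δ / 3 := fun x => ((h - g).norm_coe_le_norm x).trans hgd.le
  have hsum : ‖∑ i ∈ Finset.range l, (h ((((i + m : ℕ) : ℝ) * a n : ℝ) : AddCircle T) -
      g ((((i + m : ℕ) : ℝ) * a n : ℝ) : AddCircle T))‖ ≤ l * (δ / 3) := by
    refine (norm_sum_le_of_le _ fun i _ => hpt _).trans ?_
    simp
  have hintg : ‖(∫ x, h x ∂(AddCircle.haarAddCircle (T := T))) -
      ∫ x, g x ∂(AddCircle.haarAddCircle (T := T))‖ ≤ δ / 3 := by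
    rw [← integral_sub (cm_integrable h) (cm_integrable g)]
    refine (norm_integral_le_of_norm_le_const (ae_of_all _ hpt)).trans ?_
    simp
  have hintg' : ‖(l : ℂ) * ((∫ x, h x ∂(AddCircle.haarAddCircle (T := T))) -
      ∫ x, g x ∂(AddCircle.haarAddCircle (T := T)))‖ ≤ l * (δ / 3) := by
    rw [norm_mul, Complex.norm_natCast]
    gcongr
  have key : ∀ A B C D E F : ℂ, A = B + C - E → C = D → ‖B‖ ≤ l * (δ / 3) → ‖D‖ ≤ l * (δ / 3) →
      ‖E‖ ≤ l * (δ / 3) → ‖A‖ ≤ l * δ := by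
    intro A B C D E F hA hCD hB hD hE
    rw [hA, hCD]
    refine (norm_sub_le _ _).trans ?_
    have := norm_add_le B D
    linarith
  refine key _ _ _ _ _ 0 ?_ rfl hsum h1 hintg'
  rw [Finset.sum_sub_distrib]
  ring

lemma equi_real {T : ℝ} [hT : Fact (0 < T)] {a : ℕ → ℝ} {θ : ℝ} (ha : Tendsto a atTop (𝓝 θ))
    (hθ : ∀ k : ℤ, k ≠ 0 → fourier k (θ : AddCircle T) ≠ 1) (m : ℕ) (h : C(AddCircle T, ℝ)) :
    ∀ δ > 0, ∀ᶠ n in atTop, ∀ᶠ l : ℕ in atTop,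
      |∑ i ∈ Finset.range l, h ((((i + m : ℕ) : ℝ) * a n : ℝ) : AddCircle T) -
        l * ∫ x, h x ∂(AddCircle.haarAddCircle (T := T))| ≤ l * δ := by
  intro δ hδ
  have := equi_complex ha hθ m ⟨fun x => (h x : ℂ), by fun_prop⟩ δ hδ
  filter_upwards [this] with n h1
  filter_upwards [h1] with l h1
  simp only [ContinuousMap.coe_mk] at h1
  rw [integral_complex_ofReal] at h1
  rw [← Real.norm_eq_abs, ← Complex.norm_real]
  push_cast at h1 ⊢
  exact h1

/-! ### Limit inferior in probability of the information density -/

lemma infoDens_eq {sX sW : ℕ → ℝ} (hX : ∀ i, 0 ≤ sX i) (hW : ∀ i, 0 < sW i) (k : ℕ)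
    (x w : Fin k → ℝ) :
    infoDensRate sX sW k x w = (1 / (k : ℝ)) *
      (idens (fun i : Fin k => sW ((i : ℕ) + 1))
        (fun i : Fin k => sX ((i : ℕ) + 1) + sW ((i : ℕ) + 1)) x (fun i => x i + w i)
        / Real.log 2) := by
  unfold infoDensRate idens
  rw [Finset.sum_div]
  congr 1
  refine Finset.sum_congr rfl fun i _ => ?_
  rw [gpdf_ratio (hW _) (add_pos_of_nonneg_of_pos (hX _) (hW _)), Real.logb, Real.log_exp]

instance inputNoise_prob (sX sW : ℕ → ℝ) (k : ℕ) :
    IsProbabilityMeasure (inputNoiseMeasure sX sW k) := by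
  unfold inputNoiseMeasure; infer_instance

/-- The deviation event of the information density. -/
def devEvent (sX sW : ℕ → ℝ) (k : ℕ) (c : ℝ) : Set ((Fin k → ℝ) × (Fin k → ℝ)) :=
  {q | c ≤ |idens (fun i : Fin k => sW ((i : ℕ) + 1))
        (fun i : Fin k => sX ((i : ℕ) + 1) + sW ((i : ℕ) + 1)) q.1 (fun i => q.1 i + q.2 i)
      - ∑ i : Fin k, 1 / 2 * Real.log
        ((sX ((i : ℕ) + 1) + sW ((i : ℕ) + 1)) / sW ((i : ℕ) + 1))|}

lemma devEvent_tendsto {sX sW : ℕ → ℝ} (hX : ∀ i, 0 ≤ sX i) (hW : ∀ i, 0 < sW i) {η : ℝ}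
    (hη : 0 < η) :
    Tendsto (fun k : ℕ => ((inputNoiseMeasure sX sW k) (devEvent sX sW k (k * η))).toReal)
      atTop (𝓝 0) := by
  have h0 : Tendsto (fun k : ℕ => K4 / η ^ 2 * (1 / (k : ℝ))) atTop (𝓝 0) := by
    have := (tendsto_one_div_atTop_nhds_zero_nat (𝕜 := ℝ)).const_mul (K4 / η ^ 2)
    rwa [mul_zero] at this
  refine squeeze_zero' (Eventually.of_forall fun k => ENNReal.toReal_nonneg) ?_ h0
  filter_upwards [eventually_ge_atTop 1] with k hk
  have hk' : (0 : ℝ) < k := by exact_mod_cast hk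
  have h := idens_cheb (s := fun i : Fin k => sX ((i : ℕ) + 1))
    (σ := fun i : Fin k => sW ((i : ℕ) + 1)) (fun i => hX _) (fun i => hW _)
    (c := k * η) (by positivity)
  have h2 := ENNReal.toReal_mono ENNReal.ofReal_ne_top h
  have hK := K4_nonneg
  rw [ENNReal.toReal_ofReal (by positivity)] at h2
  refine le_trans h2 (le_of_eq ?_)
  field_simp

lemma pliminf_ge {sX sW : ℕ → ℝ} (hX : ∀ i, 0 ≤ sX i) (hW : ∀ i, 0 < sW i) {K R : ℝ}
    (hK : ∀ i, 1 / 2 * Real.log ((sX i + sW i) / sW i) ≤ K)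
    (hR : ∀ δ > (0 : ℝ), ∀ᶠ k : ℕ in atTop, k * (R * Real.log 2 - δ) ≤
      ∑ i ∈ Finset.range k, 1 / 2 * Real.log ((sX (i + 1) + sW (i + 1)) / sW (i + 1))) :
    R ≤ pliminfInfoDens sX sW := by
  have hl2 : 0 < Real.log 2 := Real.log_pos (by norm_num)
  unfold pliminfInfoDens
  have hbdd : BddAbove {α : ℝ | Tendsto (fun k => ((inputNoiseMeasure sX sW k)
      {xw | infoDensRate sX sW k xw.1 xw.2 < α}).toReal) atTop (nhds 0)} := by
    refine ⟨(K + 1) / Real.log 2, fun α hα => ?_⟩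
    by_contra! hlt
    have hα' : Tendsto (fun k => ((inputNoiseMeasure sX sW k)
      {xw | infoDensRate sX sW k xw.1 xw.2 < α}).toReal) atTop (nhds 0) := hα
    have hsum := hα'.add (devEvent_tendsto hX hW one_pos)
    rw [add_zero] at hsum
    have h1 : ∀ᶠ k : ℕ in atTop, (1 : ℝ) ≤ ((inputNoiseMeasure sX sW k)
      {xw | infoDensRate sX sW k xw.1 xw.2 < α}).toReal +
      ((inputNoiseMeasure sX sW k) (devEvent sX sW k (k * 1))).toReal := by
      filter_upwards [eventually_ge_atTop 1] with k hk
      have hk' : (0 : ℝ) < k := by exact_mod_cast hk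
      rw [← ENNReal.toReal_add (measure_ne_top _ _) (measure_ne_top _ _)]
      have : (1 : ℝ≥0∞) ≤ (inputNoiseMeasure sX sW k)
        {xw | infoDensRate sX sW k xw.1 xw.2 < α} +
        (inputNoiseMeasure sX sW k) (devEvent sX sW k (k * 1)) := by
        refine le_trans ?_ (measure_union_le _ _)
        rw [← measure_univ (μ := inputNoiseMeasure sX sW k)]
        refine measure_mono fun q _ => ?_
        by_cases hq : infoDensRate sX sW k q.1 q.2 < α
        · exact Or.inl hq
        · refine Or.inr ?_
          rw [infoDens_eq hX hW] at hq
          push Not at hq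
          unfold devEvent
          rw [Set.mem_ofPred_eq]
          refine le_trans ?_ (le_abs_self _)
          have hm : ∑ i : Fin k, 1 / 2 * Real.log
            ((sX ((i : ℕ) + 1) + sW ((i : ℕ) + 1)) / sW ((i : ℕ) + 1)) ≤ k * K := by
            refine le_trans (Finset.sum_le_sum fun i _ => hK _) (le_of_eq ?_)
            simp
          rw [div_lt_iff₀ hl2] at hlt
          rw [one_div, ← div_eq_inv_mul, le_div_iff₀ hk', le_div_iff₀ hl2] at hq
          nlinarith
      have h3 := ENNReal.toReal_mono (by finiteness) this
      simpa using h3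
    exact absurd (ge_of_tendsto hsum h1) (by norm_num)
  refine le_of_forall_pos_le_add fun δ hδ => ?_
  rw [← sub_le_iff_le_add]
  refine le_csSup hbdd ?_
  have hη : 0 < δ * Real.log 2 / 2 := by positivity
  refine squeeze_zero' (Eventually.of_forall fun k => ENNReal.toReal_nonneg) ?_
    (devEvent_tendsto hX hW hη)
  filter_upwards [eventually_ge_atTop 1, hR _ hη] with k hk hRk
  have hk' : (0 : ℝ) < k := by exact_mod_cast hk
  refine ENNReal.toReal_mono (measure_ne_top _ _) (measure_mono fun q hq => ?_)
  have hq' : infoDensRate sX sW k q.1 q.2 < R - δ := hq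
  rw [infoDens_eq hX hW, one_div, ← div_eq_inv_mul, div_lt_iff₀ hk', div_lt_iff₀ hl2] at hq'
  unfold devEvent
  rw [Set.mem_ofPred_eq]
  refine le_trans ?_ (neg_le_abs _)
  rw [Finset.sum_range] at hRk
  nlinarith

/-! ### Irrational rotation -/

lemma fourier_ne_one {T : ℝ} (hT : 0 < T) (p : ℕ) {ε : ℝ} (hε : 0 < ε) (hirr : Irrational ε)
    (k : ℤ) (hk : k ≠ 0) : fourier k ((T / ((p : ℝ) + ε) : ℝ) : AddCircle T) ≠ 1 := by
  rw [fourier_coe_apply]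
  intro h
  rw [Complex.exp_eq_one_iff] at h
  obtain ⟨j, hj⟩ := h
  have hpe : (0 : ℝ) < p + ε := by positivity
  have h2 : ((k : ℝ) / (p + ε) : ℝ) = (j : ℝ) := by
    have hpi : (2 * (Real.pi : ℂ) * Complex.I) ≠ 0 := Complex.two_pi_I_ne_zero
    have hTc : (T : ℂ) ≠ 0 := by exact_mod_cast hT.ne'
    have hpc : ((p : ℂ) + (ε : ℂ)) ≠ 0 := by exact_mod_cast hpe.ne'
    have : ((k : ℂ) / ((p : ℂ) + ε)) = (j : ℂ) := by
      apply mul_left_cancel₀ hpi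
      rw [mul_comm _ (j : ℂ), ← hj]
      push_cast
      field_simp
    exact_mod_cast this
  rw [div_eq_iff hpe.ne'] at h2
  have hj0 : j ≠ 0 := by
    rintro rfl
    simp at h2
    exact hk h2
  have hj0' : (j : ℝ) ≠ 0 := by exact_mod_cast hj0
  apply hirr
  refine ⟨(k : ℚ) / j - p, ?_⟩
  push_cast
  field_simp
  linarith

lemma eps_tendsto (ε : ℝ) :
    Tendsto (fun n : ℕ => (⌊(n : ℝ) * ε⌋ : ℝ) / (n : ℝ)) atTop (𝓝 ε) := by
  have h := tendsto_one_div_atTop_nhds_zero_nat (𝕜 := ℝ)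
  rw [tendsto_iff_norm_sub_tendsto_zero]
  refine squeeze_zero' (Eventually.of_forall fun _ => norm_nonneg _) ?_ h
  filter_upwards [eventually_ge_atTop 1] with n hn
  have hn' : (0 : ℝ) < n := by exact_mod_cast hn
  have h1 := Int.floor_le ((n : ℝ) * ε)
  have h2 := Int.lt_floor_add_one ((n : ℝ) * ε)
  have : (⌊(n : ℝ) * ε⌋ : ℝ) / (n : ℝ) - ε = (⌊(n : ℝ) * ε⌋ - n * ε) / n := by
    field_simp
  rw [this, Real.norm_eq_abs, abs_div, abs_of_pos hn']
  gcongr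
  rw [abs_le]
  constructor <;> linarith

lemma a_tendsto (T : ℝ) (p : ℕ) {ε : ℝ} (hε : 0 < ε) :
    Tendsto (fun n : ℕ => T / ((p : ℝ) + (⌊(n : ℝ) * ε⌋ : ℝ) / (n : ℝ))) atTop
      (𝓝 (T / ((p : ℝ) + ε))) := by
  refine tendsto_const_nhds.div (tendsto_const_nhds.add (eps_tendsto ε)) ?_
  positivity

/-! ### Capacity bookkeeping -/

lemma zero_achievable (σ2 : ℕ → ℝ) {P : ℝ} (hP : 0 < P) : IsAchievableRate σ2 P 0 := by
  intro η₁ h1 η₂ h2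
  refine ⟨0, fun l hl => ⟨1, fun _ _ => 0, fun _ => 0, ?_, ?_, ?_⟩⟩
  · intro u
    unfold powerConstraint
    simp [hP.le]
  · unfold avgError
    have : ∀ u : Fin 1, (0 : Fin 1) = u := fun u => Subsingleton.elim _ _
    simpa [this] using h1
  · simp [h2.le]

lemma capacity_nonneg (σ2 : ℕ → ℝ) {P : ℝ} (hP : 0 < P) : 0 ≤ capacity σ2 P :=
  Real.sSup_nonneg' ⟨0, zero_achievable σ2 hP, le_rfl⟩

lemma capacity_le (σ2 : ℕ → ℝ) {P B : ℝ} (hP : 0 < P)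
    (h : ∀ R, IsAchievableRate σ2 P R → R ≤ B) : capacity σ2 P ≤ B :=
  csSup_le ⟨0, zero_achievable σ2 hP⟩ h

/-- Bernoulli-type inequality for the logarithm. -/
lemma log_scale {a r : ℝ} (ha : 0 ≤ a) (h0 : 0 ≤ r) (h1 : r ≤ 1) :
    r * Real.log (1 + a) ≤ Real.log (1 + r * a) := by
  rw [← Real.log_rpow (by linarith)]
  exact Real.log_le_log (Real.rpow_pos_of_pos (by linarith) _)
    (rpow_one_add_le_one_add_mul_self (by linarith) h0 h1)

lemma log_scale' {s σ r : ℝ} (hs : 0 ≤ s) (hσ : 0 < σ) (h0 : 0 ≤ r) (h1 : r ≤ 1) :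
    r * (1 / 2 * Real.log ((s + σ) / σ)) ≤ 1 / 2 * Real.log ((r * s + σ) / σ) := by
  have h := log_scale (a := s / σ) (by positivity) h0 h1
  have e1 : (s + σ) / σ = 1 + s / σ := by field_simp; ring
  have e2 : (r * s + σ) / σ = 1 + r * (s / σ) := by field_simp; ring
  rw [e1, e2]
  linarith

/-- Existence of the water level. -/
lemma exists_water {T : ℝ} [Fact (0 < T)] (c : C(AddCircle T, ℝ)) (hc : ∀ x, 0 < c x) {P : ℝ}
    (hP : 0 < P) : ∃ ν > (0 : ℝ), ∫ x, (max ν (c x) - c x) ∂AddCircle.haarAddCircle = P := by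
  let J : ℝ → ℝ := fun ν => ∫ x, (max ν (c x) - c x) ∂(AddCircle.haarAddCircle (T := T))
  have hintg : ∀ ν : ℝ, Integrable (fun x => max ν (c x) - c x)
      (AddCircle.haarAddCircle (T := T)) := fun ν =>
    cm_integrable (⟨fun x => max ν (c x) - c x, by fun_prop⟩ : C(AddCircle T, ℝ))
  have hlip : LipschitzWith 1 J := by
    refine LipschitzWith.of_dist_le_mul fun a b => ?_
    rw [Real.dist_eq, Real.dist_eq]
    change |(∫ x, _ ∂_) - ∫ x, _ ∂_| ≤ _
    rw [← integral_sub (hintg a) (hintg b), ← Real.norm_eq_abs]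
    refine le_trans (norm_integral_le_of_norm_le_const
      (Eventually.of_forall fun x => ?_ : ∀ᵐ x ∂_, _ ≤ |a - b|)) ?_
    · rw [Real.norm_eq_abs]
      have := abs_max_sub_max_le_abs a b (c x)
      simpa using this
    · simp
  have h0 : J 0 = 0 := by
    change ∫ x, _ ∂_ = _
    simp [fun x => max_eq_right (hc x).le]
  obtain ⟨B, hB⟩ := (isCompact_range c.continuous).bddAbove
  have hBx : ∀ x, c x ≤ B := fun x => hB ⟨x, rfl⟩
  have hB0 : 0 ≤ B := (hc 0).le.trans (hBx 0)
  have h1 : P ≤ J (P + B) := by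
    have : ∫ x, P ∂(AddCircle.haarAddCircle (T := T)) ≤ J (P + B) := by
      refine integral_mono (integrable_const _) (hintg _) fun x => ?_
      have := le_max_left (P + B) (c x)
      have := hBx x
      simp only
      linarith
    simpa using this
  have := intermediate_value_Icc (by linarith : (0 : ℝ) ≤ P + B) hlip.continuous.continuousOn
  obtain ⟨ν, hν, hJ⟩ := this ⟨h0.le.trans hP.le, h1⟩
  refine ⟨ν, lt_of_le_of_ne hν.1 ?_, hJ⟩
  rintro rfl
  linarith

/-! ### Construction of the Gaussian input -/

lemma exists_scaling {s : ℕ → ℝ} {S P : ℝ} (hP : 0 < P) (hs : ∀ i, 0 ≤ s i)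
    (hS : ∀ i, s i ≤ S)
    (hlim : ∀ δ > (0 : ℝ), ∀ᶠ k : ℕ in atTop,
      ∑ i ∈ Finset.range k, s (i + 1) ≤ k * (P + δ)) :
    ∃ r : ℕ → ℝ, (∀ i, 0 ≤ r i) ∧ (∀ i, r i ≤ 1) ∧ Tendsto r atTop (𝓝 1) ∧
      ∀ k : ℕ, ∑ i ∈ Finset.range k, r (i + 1) * s (i + 1) ≤ k * P := by
  let b : ℕ → ℝ := fun k => (∑ i ∈ Finset.range k, s (i + 1)) / k
  have hbS : ∀ k, b k ≤ max P S := by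
    intro k
    rcases Nat.eq_zero_or_pos k with rfl | hk
    · simp [b, hP.le]
    · have hk' : (0 : ℝ) < k := by exact_mod_cast hk
      refine le_trans ?_ (le_max_right _ _)
      simp only [b]
      rw [div_le_iff₀ hk']
      refine le_trans (Finset.sum_le_sum fun i _ => hS _) (le_of_eq ?_)
      simp [mul_comm]
  let M : ℕ → ℝ := fun k => ⨆ j : ℕ, max P (b (k + j))
  have hbdd : ∀ k, BddAbove (Set.range fun j : ℕ => max P (b (k + j))) := by
    intro k
    refine ⟨max P S, ?_⟩
    rintro _ ⟨j, rfl⟩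
    exact max_le (le_max_left _ _) (hbS _)
  have hMle : ∀ k j, max P (b (k + j)) ≤ M k := fun k j => le_ciSup (hbdd k) j
  have hPM : ∀ k, P ≤ M k := fun k => (le_max_left _ _).trans (hMle k 0)
  have hbM : ∀ k, b k ≤ M k := fun k => (le_max_right P (b (k + 0))).trans (hMle k 0)
  have hMpos : ∀ k, 0 < M k := fun k => hP.trans_le (hPM k)
  have hanti : ∀ i k, i ≤ k → M k ≤ M i := by
    intro i k hik
    refine ciSup_le fun j => ?_
    have := hMle i (k - i + j)
    rwa [show i + (k - i + j) = k + j by omega] at this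
  have hMlim : Tendsto M atTop (𝓝 P) := by
    rw [Metric.tendsto_atTop]
    intro δ hδ
    obtain ⟨N, hN⟩ := eventually_atTop.1 (hlim (δ / 2) (by positivity))
    refine ⟨N + 1, fun k hk => ?_⟩
    have : M k ≤ P + δ / 2 := by
      refine ciSup_le fun j => max_le (by linarith) ?_
      have hk' : (0 : ℝ) < ((k + j : ℕ) : ℝ) := by
        have : 0 < k + j := by omega
        exact_mod_cast this
      simp only [b]
      rw [div_le_iff₀ hk', mul_comm]
      exact hN (k + j) (by omega)
    rw [Real.dist_eq, abs_of_nonneg (by linarith [hPM k])]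
    linarith
  refine ⟨fun k => P / M k, fun i => by have := hMpos i; positivity,
    fun i => by rw [div_le_one (hMpos i)]; exact hPM i, ?_, fun k => ?_⟩
  · have := (tendsto_const_nhds (x := P)).div hMlim hP.ne'
    rwa [div_self hP.ne'] at this
  · rcases Nat.eq_zero_or_pos k with rfl | hk
    · simp
    have hk' : (0 : ℝ) < k := by exact_mod_cast hk
    have h1 : ∑ i ∈ Finset.range k, P / M (i + 1) * s (i + 1) ≤
        ∑ i ∈ Finset.range k, P / M k * s (i + 1) := by
      refine Finset.sum_le_sum fun i hi => ?_
      refine mul_le_mul_of_nonneg_right ?_ (hs _)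
      exact div_le_div_of_nonneg_left hP.le (hMpos _)
        (hanti _ _ (by have := Finset.mem_range.1 hi; omega))
    refine h1.trans ?_
    rw [← Finset.mul_sum]
    have h2 : ∑ i ∈ Finset.range k, s (i + 1) ≤ k * M k := by
      have := hbM k
      simp only [b] at this
      rw [div_le_iff₀ hk'] at this
      linarith
    have hM := hMpos k
    calc P / M k * ∑ i ∈ Finset.range k, s (i + 1) ≤ P / M k * (k * M k) := by gcongr
      _ = k * P := by field_simp

lemma cesaro_small {r g : ℕ → ℝ} {K : ℝ} (hr : Tendsto r atTop (𝓝 1))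
    (hr1 : ∀ i, r i ≤ 1) (hg0 : ∀ i, 0 ≤ g i) (hgK : ∀ i, g i ≤ K) :
    ∀ δ > (0 : ℝ), ∀ᶠ k : ℕ in atTop,
      ∑ i ∈ Finset.range k, (1 - r (i + 1)) * g (i + 1) ≤ k * δ := by
  intro δ hδ
  have h1 : Tendsto (fun i => (1 - r (i + 1)) * K) atTop (𝓝 0) := by
    have := ((tendsto_const_nhds (x := (1 : ℝ))).sub
      (hr.comp (tendsto_add_atTop_nat 1))).mul_const K
    simpa using this
  have h2 := h1.cesaro
  filter_upwards [h2.eventually_lt_const hδ, eventually_ge_atTop 1] with k hk hk1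
  have hk' : (0 : ℝ) < k := by exact_mod_cast hk1
  rw [← div_eq_inv_mul, div_lt_iff₀ hk'] at hk
  refine le_trans (Finset.sum_le_sum fun i _ => ?_) (by rw [mul_comm]; exact hk.le)
  exact mul_le_mul_of_nonneg_left (hgK _) (by linarith [hr1 (i + 1)])

/-! ### Assembly -/

/-- The water-filling rate function (in nats). -/
noncomputable def wfRate {T : ℝ} (c : C(AddCircle T, ℝ)) (hc : ∀ x, 0 < c x) (ν : ℝ)
    (hν : 0 < ν) : C(AddCircle T, ℝ) :=
  ⟨fun x => 1 / 2 * Real.log (max ν (c x) / c x), by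
    refine continuous_const.mul (Continuous.log ?_ ?_)
    · exact Continuous.div (by fun_prop) (by fun_prop) (fun x => (hc x).ne')
    · intro x
      have := hc x
      positivity⟩

/-- The water-filling power function. -/
noncomputable def wfPow {T : ℝ} (c : C(AddCircle T, ℝ)) (ν : ℝ) : C(AddCircle T, ℝ) :=
  ⟨fun x => max ν (c x) - c x, by fun_prop⟩

lemma wfPow_nonneg {T : ℝ} (c : C(AddCircle T, ℝ)) (ν : ℝ) (x : AddCircle T) :
    0 ≤ wfPow c ν x := sub_nonneg.2 (le_max_right _ _)

lemma wfPow_le {T : ℝ} (c : C(AddCircle T, ℝ)) (hc : ∀ x, 0 < c x) {ν : ℝ} (hν : 0 < ν)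
    (x : AddCircle T) : wfPow c ν x ≤ ν := by
  change max ν (c x) - c x ≤ ν
  have := hc x
  rw [sub_le_iff_le_add]
  exact max_le (by linarith) (by linarith)

lemma wfRate_nonneg {T : ℝ} (c : C(AddCircle T, ℝ)) (hc : ∀ x, 0 < c x) {ν : ℝ} (hν : 0 < ν)
    (x : AddCircle T) : 0 ≤ wfRate c hc ν hν x := by
  change 0 ≤ 1 / 2 * Real.log (max ν (c x) / c x)
  have := hc x
  have : 0 ≤ Real.log (max ν (c x) / c x) :=
    Real.log_nonneg ((one_le_div this).2 (le_max_right _ _))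
  positivity

lemma wfRate_eq {T : ℝ} (c : C(AddCircle T, ℝ)) (hc : ∀ x, 0 < c x) {ν : ℝ} (hν : 0 < ν)
    (x : AddCircle T) :
    wfRate c hc ν hν x = 1 / 2 * Real.log ((wfPow c ν x + c x) / c x) := by
  change 1 / 2 * Real.log (max ν (c x) / c x)
    = 1 / 2 * Real.log ((max ν (c x) - c x + c x) / c x)
  rw [sub_add_cancel]

/-- Uniform converse bound. -/
lemma wf_converse {T : ℝ} [Fact (0 < T)] (c : C(AddCircle T, ℝ)) (hc : ∀ x, 0 < c x)
    {ν P : ℝ} (hν : 0 < ν) (hP : 0 < P)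
    (hw : ∫ x, wfPow c ν x ∂AddCircle.haarAddCircle = P)
    {a : ℕ → ℝ} {θ : ℝ} (ha : Tendsto a atTop (𝓝 θ))
    (hθ : ∀ k : ℤ, k ≠ 0 → fourier k (θ : AddCircle T) ≠ 1) :
    ∀ η > (0 : ℝ), ∀ᶠ n in atTop, ∀ R,
      IsAchievableRate (fun i : ℕ => c (((i : ℝ) * a n : ℝ) : AddCircle T)) P R →
      R ≤ (∫ x, wfRate c hc ν hν x ∂AddCircle.haarAddCircle) / Real.log 2 + η := by
  intro η hη
  have hl2 : 0 < Real.log 2 := Real.log_pos (by norm_num)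
  set G := ∫ x, wfRate c hc ν hν x ∂AddCircle.haarAddCircle with hG
  set δ := η * Real.log 2 / (1 + 1 / (2 * ν)) with hδ
  have hδ0 : 0 < δ := by positivity
  filter_upwards [equi_real ha hθ 0 (wfRate c hc ν hν) δ hδ0,
    equi_real ha hθ 0 (wfPow c ν) δ hδ0] with n h1 h2 R hR
  have := converse (G := G + δ) (S := P - δ) (fun i => hc _) hν hP ?_ ?_ hR
  · have e : δ * (1 + 1 / (2 * ν)) = η * Real.log 2 := by
      rw [hδ]; field_simp
    have e2 : (P - (P - δ)) / (2 * ν) = δ * (1 / (2 * ν)) := by ring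
    rw [e2] at this
    rw [← sub_le_iff_le_add, le_div_iff₀ hl2]
    linarith
  · filter_upwards [h1] with l hl
    have := (abs_le.1 hl).2
    simp only [add_zero] at this
    have e : ∑ i ∈ Finset.range l, wfRate c hc ν hν (((i : ℝ) * a n : ℝ) : AddCircle T)
      = ∑ i ∈ Finset.range l, 1 / 2 * Real.log (max ν (c (((i : ℝ) * a n : ℝ) : AddCircle T))
        / c (((i : ℝ) * a n : ℝ) : AddCircle T)) := rfl
    rw [← e]
    linarith
  · filter_upwards [h2] with l hl
    have := (abs_le.1 hl).1
    simp only [add_zero] at this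
    have e : ∑ i ∈ Finset.range l, wfPow c ν (((i : ℝ) * a n : ℝ) : AddCircle T)
      = ∑ i ∈ Finset.range l, (max ν (c (((i : ℝ) * a n : ℝ) : AddCircle T))
        - c (((i : ℝ) * a n : ℝ) : AddCircle T)) := rfl
    rw [← e]
    rw [hw] at this
    linarith

/-- Equidistribution along a fixed rotation. -/
lemma equi_const {T : ℝ} [Fact (0 < T)] {θ : ℝ}
    (hθ : ∀ k : ℤ, k ≠ 0 → fourier k (θ : AddCircle T) ≠ 1) (m : ℕ) (h : C(AddCircle T, ℝ)) :
    ∀ δ > (0 : ℝ), ∀ᶠ l : ℕ in atTop,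
      |∑ i ∈ Finset.range l, h ((((i + m : ℕ) : ℝ) * θ : ℝ) : AddCircle T)
        - l * ∫ x, h x ∂AddCircle.haarAddCircle| ≤ l * δ := by
  intro δ hδ
  exact (equi_real (tendsto_const_nhds (x := θ) (f := (atTop : Filter ℕ))) hθ m h δ hδ).exists.choose_spec

/-- Direct part: the capacity is at least the water-filling rate. -/
lemma wf_direct {T : ℝ} [Fact (0 < T)] (c : C(AddCircle T, ℝ)) (hc : ∀ x, 0 < c x)
    {ν P : ℝ} (hν : 0 < ν) (hP : 0 < P)
    (hw : ∫ x, wfPow c ν x ∂AddCircle.haarAddCircle = P) {θ : ℝ}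
    (hθ : ∀ k : ℤ, k ≠ 0 → fourier k (θ : AddCircle T) ≠ 1) :
    (∫ x, wfRate c hc ν hν x ∂AddCircle.haarAddCircle) / Real.log 2 ≤
      capacity (fun i : ℕ => c (((i : ℝ) * θ : ℝ) : AddCircle T)) P := by
  have hl2 : 0 < Real.log 2 := Real.log_pos (by norm_num)
  set G := ∫ x, wfRate c hc ν hν x ∂AddCircle.haarAddCircle with hG
  have hG0 : 0 ≤ G := integral_nonneg (wfRate_nonneg c hc hν)
  have hbdd : BddAbove {R | IsAchievableRate
      (fun i : ℕ => c (((i : ℝ) * θ : ℝ) : AddCircle T)) P R} := by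
    have h := (wf_converse c hc hν hP hw (tendsto_const_nhds (x := θ) (f := (atTop : Filter ℕ)))
      hθ 1 one_pos).exists
    exact ⟨G / Real.log 2 + 1, fun R hR => h.choose_spec R hR⟩
  rcases hG0.eq_or_lt with h0 | hGpos
  · rw [← h0, zero_div]
    exact capacity_nonneg _ hP
  have key : ∀ δ : ℝ, 0 < δ → δ < 1 → (1 - δ) * (G / Real.log 2) ≤
      capacity (fun i : ℕ => c (((i : ℝ) * θ : ℝ) : AddCircle T)) P := by
    intro δ hδ0 hδ1
    refine le_csSup hbdd ?_
    have h1δ : 0 < 1 - δ := by linarith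
    refine achievability (s := fun i : ℕ => (1 - δ) * wfPow c ν (((i : ℝ) * θ : ℝ) : AddCircle T))
      (S := ν) (P' := (1 - δ / 2) * P) (fun i => mul_nonneg h1δ.le (wfPow_nonneg c ν _))
      (fun i => ?_) (fun i => hc _) (by nlinarith) (by positivity) ?_ ?_
    · have h1 := wfPow_le c hc hν (((i : ℝ) * θ : ℝ) : AddCircle T)
      have h2 := wfPow_nonneg c ν (((i : ℝ) * θ : ℝ) : AddCircle T)
      nlinarith
    · filter_upwards [equi_const hθ 0 (wfPow c ν) (δ * P / 2) (by positivity)] with l hl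
      have h := (abs_le.1 hl).2
      simp only [add_zero] at h
      rw [hw] at h
      rw [← Finset.mul_sum]
      have hl0 : (0 : ℝ) ≤ l := Nat.cast_nonneg l
      calc (1 - δ) * ∑ i ∈ Finset.range l, wfPow c ν (((i : ℝ) * θ : ℝ) : AddCircle T)
          ≤ (1 - δ) * (l * P + l * (δ * P / 2)) := by
            apply mul_le_mul_of_nonneg_left _ h1δ.le
            linarith
        _ = l * ((1 - δ / 2) * P) - l * P * δ ^ 2 / 2 := by ring
        _ ≤ l * ((1 - δ / 2) * P) := by
            have : 0 ≤ l * P * δ ^ 2 / 2 := by positivity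
            linarith
    · intro δ' hδ'
      filter_upwards [equi_const hθ 0 (wfRate c hc ν hν) δ' hδ'] with l hl
      have h := (abs_le.1 hl).1
      simp only [add_zero] at h
      have hsum : (1 - δ) * ∑ i ∈ Finset.range l,
          wfRate c hc ν hν (((i : ℝ) * θ : ℝ) : AddCircle T) ≤
          ∑ i ∈ Finset.range l, 1 / 2 * Real.log
            (((1 - δ) * wfPow c ν (((i : ℝ) * θ : ℝ) : AddCircle T)
              + c (((i : ℝ) * θ : ℝ) : AddCircle T)) / c (((i : ℝ) * θ : ℝ) : AddCircle T)) := by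
        rw [Finset.mul_sum]
        refine Finset.sum_le_sum fun i _ => ?_
        rw [wfRate_eq]
        exact log_scale' (wfPow_nonneg c ν _) (hc _) h1δ.le (by linarith)
      refine le_trans ?_ hsum
      have hl0 : (0 : ℝ) ≤ l := Nat.cast_nonneg l
      have e : (1 - δ) * (G / Real.log 2) * Real.log 2 = (1 - δ) * G := by field_simp
      rw [e]
      have h3 : l * G - l * δ' ≤ ∑ i ∈ Finset.range l,
          wfRate c hc ν hν (((i : ℝ) * θ : ℝ) : AddCircle T) := by linarith
      calc (l : ℝ) * ((1 - δ) * G - δ') = (1 - δ) * (l * G - l * δ') - δ * (l * δ') := by ring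
        _ ≤ (1 - δ) * (l * G - l * δ') := by
          have : 0 ≤ δ * (l * δ') := by positivity
          linarith
        _ ≤ _ := mul_le_mul_of_nonneg_left h3 h1δ.le
  have hlim : Tendsto (fun δ : ℝ => (1 - δ) * (G / Real.log 2)) (𝓝[>] 0)
      (𝓝 (G / Real.log 2)) := by
    have : Tendsto (fun δ : ℝ => (1 - δ) * (G / Real.log 2)) (𝓝 0)
      (𝓝 ((1 - 0) * (G / Real.log 2))) := by
      apply Continuous.tendsto
      fun_prop
    rw [sub_zero, one_mul] at this
    exact this.mono_left nhdsWithin_le_nhds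
  refine le_of_tendsto hlim ?_
  filter_upwards [Ioo_mem_nhdsGT (zero_lt_one (α := ℝ))] with δ hδ
  exact key δ hδ.1 hδ.2

/-- A Gaussian input attains the water-filling rate. -/
lemma wf_gaussian {T : ℝ} [Fact (0 < T)] (c : C(AddCircle T, ℝ)) (hc : ∀ x, 0 < c x)
    {ν P : ℝ} (hν : 0 < ν) (hP : 0 < P)
    (hw : ∫ x, wfPow c ν x ∂AddCircle.haarAddCircle = P) {θ : ℝ}
    (hθ : ∀ k : ℤ, k ≠ 0 → fourier k (θ : AddCircle T) ≠ 1) :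
    ∃ sX : ℕ → ℝ, (∀ i, 0 ≤ sX i) ∧
      (∀ k : ℕ, 0 < k → (1 / (k : ℝ)) * ∑ i ∈ Finset.range k, sX (i + 1) ≤ P) ∧
      (∫ x, wfRate c hc ν hν x ∂AddCircle.haarAddCircle) / Real.log 2 ≤
        pliminfInfoDens sX (fun i : ℕ => c (((i : ℝ) * θ : ℝ) : AddCircle T)) := by
  have hl2 : 0 < Real.log 2 := Real.log_pos (by norm_num)
  set G := ∫ x, wfRate c hc ν hν x ∂AddCircle.haarAddCircle with hG
  let s : ℕ → ℝ := fun i => wfPow c ν (((i : ℝ) * θ : ℝ) : AddCircle T)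
  let g : ℕ → ℝ := fun i => wfRate c hc ν hν (((i : ℝ) * θ : ℝ) : AddCircle T)
  let σ : ℕ → ℝ := fun i => c (((i : ℝ) * θ : ℝ) : AddCircle T)
  have hs0 : ∀ i, 0 ≤ s i := fun i => wfPow_nonneg c ν _
  have hg0 : ∀ i, 0 ≤ g i := fun i => wfRate_nonneg c hc hν _
  have hσ : ∀ i, 0 < σ i := fun i => hc _
  have hgs : ∀ i, g i = 1 / 2 * Real.log ((s i + σ i) / σ i) := fun i => wfRate_eq c hc hν _
  obtain ⟨K, hK⟩ := (isCompact_range (wfRate c hc ν hν).continuous).bddAbove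
  have hgK : ∀ i, g i ≤ K := fun i => hK ⟨_, rfl⟩
  obtain ⟨r, hr0, hr1, hr, hpow⟩ := exists_scaling (s := s) (S := ν) hP hs0
    (fun i => wfPow_le c hc hν _) (by
      intro δ hδ
      filter_upwards [equi_const hθ 1 (wfPow c ν) δ hδ] with k hk
      have h := (abs_le.1 hk).2
      rw [hw] at h
      change ∑ i ∈ Finset.range k, s (i + 1) - _ ≤ _ at h
      linarith)
  refine ⟨fun i => r i * s i, fun i => mul_nonneg (hr0 i) (hs0 i), fun k hk => ?_, ?_⟩
  · have hk' : (0 : ℝ) < k := by exact_mod_cast hk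
    rw [one_div, ← div_eq_inv_mul, div_le_iff₀ hk', mul_comm]
    exact hpow k
  · refine pliminf_ge (K := K) (fun i => mul_nonneg (hr0 i) (hs0 i)) hσ (fun i => ?_) ?_
    · refine le_trans ?_ (hgK i)
      rw [hgs]
      have h1 := hs0 i
      have h2 := hσ i
      have h3 := hr0 i
      have h4 := hr1 i
      have h5 : r i * s i ≤ s i := mul_le_of_le_one_left h1 h4
      have h6 : 0 ≤ r i * s i := mul_nonneg h3 h1
      change 1 / 2 * Real.log ((r i * s i + σ i) / σ i) ≤ _
      gcongr
    · intro δ hδ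
      filter_upwards [equi_const hθ 1 (wfRate c hc ν hν) (δ / 2) (by positivity),
        cesaro_small hr hr1 hg0 hgK (δ / 2) (by positivity)] with k h1 h2
      have h := (abs_le.1 h1).1
      change _ ≤ ∑ i ∈ Finset.range k, g (i + 1) - _ at h
      rw [div_mul_cancel₀ _ hl2.ne']
      have h3 : ∑ i ∈ Finset.range k, r (i + 1) * g (i + 1) ≤
          ∑ i ∈ Finset.range k, 1 / 2 * Real.log
            ((r (i + 1) * s (i + 1) + σ (i + 1)) / σ (i + 1)) := by
        refine Finset.sum_le_sum fun i _ => ?_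
        rw [hgs]
        exact log_scale' (hs0 _) (hσ _) (hr0 _) (hr1 _)
      refine le_trans ?_ h3
      have h4 : ∑ i ∈ Finset.range k, (1 - r (i + 1)) * g (i + 1)
          = ∑ i ∈ Finset.range k, g (i + 1) - ∑ i ∈ Finset.range k, r (i + 1) * g (i + 1) := by
        rw [← Finset.sum_sub_distrib]
        exact Finset.sum_congr rfl fun i _ => by ring
      rw [h4] at h2
      linarith

/-- For irrational `ε ∈ (0,1)`, assuming `1/(2π) < C(t)` for all `t`, the
capacity `C_ε` of the channel `Y_ε[i] = X[i] + W_ε[i]` (noise variances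
`σ_ε²[i] = C(i·T_c/(p+ε))`) under the average power constraint `P` satisfies
`C_ε ≥ liminf_{n→∞} C_n`, where `C_n` is the capacity of the channel with noise variances
`C(i·T_c/(p+ε_n))`, `ε_n = ⌊n·ε⌋/n`.  Moreover, a rate of `liminf_{n→∞} C_n` is achievable
over the channel `Y_ε` when the input obeys a Gaussian distribution: some memoryless zero-mean
Gaussian input satisfying the power constraint attains, as the limit-inferior in probability
of its mutual information density rates, at least `liminf_{n→∞} C_n`. -/
theorem stmt14 (C : ℝ → ℝ) (T_c : ℝ) (hT : 0 < T_c)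
    (hC_cont : Continuous C) (hC_pos : ∀ t, 0 < C t)
    (hC_per : ∀ t, C (t + T_c) = C t)
    (hC_lo : ∀ t, 1 / (2 * Real.pi) < C t)
    (p : ℕ) (hp : 0 < p) (ε : ℝ) (hε0 : 0 < ε) (hε1 : ε < 1) (hirr : Irrational ε)
    (P : ℝ) (hP : 0 < P) :
    capacity (fun i : ℕ => C ((i : ℝ) * T_c / ((p : ℝ) + ε))) P ≥
      Filter.liminf (fun n : ℕ =>
        capacity (fun i : ℕ =>
          C ((i : ℝ) * T_c / ((p : ℝ) + (⌊(n : ℝ) * ε⌋ : ℝ) / (n : ℝ)))) P) atTop ∧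
    ∃ sX : ℕ → ℝ, (∀ i, 0 ≤ sX i) ∧
      (∀ k : ℕ, 0 < k → (1 / (k : ℝ)) * ∑ i ∈ Finset.range k, sX (i + 1) ≤ P) ∧
      pliminfInfoDens sX (fun i : ℕ => C ((i : ℝ) * T_c / ((p : ℝ) + ε))) ≥
        Filter.liminf (fun n : ℕ =>
          capacity (fun i : ℕ =>
            C ((i : ℝ) * T_c / ((p : ℝ) + (⌊(n : ℝ) * ε⌋ : ℝ) / (n : ℝ)))) P) atTop := by
  haveI : Fact (0 < T_c) := ⟨hT⟩
  have hper : Function.Periodic C T_c := hC_per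
  let c : C(AddCircle T_c, ℝ) := ⟨hper.lift, by
    exact continuous_coinduced_dom.2 hC_cont⟩
  have hcC : ∀ t : ℝ, C t = c (t : AddCircle T_c) := fun t => (hper.lift_coe t).symm
  have hc : ∀ x, 0 < c x := by
    intro x
    induction x using QuotientAddGroup.induction_on with
    | H t => 
      have := hcC t
      exact this ▸ hC_pos t
  obtain ⟨ν, hν, hw⟩ := exists_water c hc hP
  have hw' : ∫ x, wfPow c ν x ∂AddCircle.haarAddCircle = P := hw
  have hθ := fun k hk => fourier_ne_one hT p hε0 hirr k hk
  have ha := a_tendsto T_c p hε0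
  simp only [mul_div_assoc, hcC]
  set G := ∫ x, wfRate c hc ν hν x ∂AddCircle.haarAddCircle with hG
  have hlim : Filter.liminf (fun n : ℕ => capacity (fun i : ℕ =>
      c (((i : ℝ) * (T_c / ((p : ℝ) + (⌊(n : ℝ) * ε⌋ : ℝ) / (n : ℝ))) : ℝ) : AddCircle T_c)) P)
      atTop ≤ G / Real.log 2 := by
    rw [Filter.liminf_eq]
    refine csSup_le ⟨0, Eventually.of_forall fun n => capacity_nonneg _ hP⟩ fun b hb => ?_
    refine le_of_forall_pos_le_add fun η hη => ?_
    obtain ⟨n, h1, h2⟩ := ((show ∀ᶠ n in atTop, _ from hb).and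
      (wf_converse c hc hν hP hw' ha hθ η hη)).exists
    exact h1.trans (capacity_le _ hP h2)
  refine ⟨hlim.trans (wf_direct c hc hν hP hw' hθ), ?_⟩
  obtain ⟨sX, h1, h2, h3⟩ := wf_gaussian c hc hν hP hw' hθ
  exact ⟨sX, h1, h2, hlim.trans h3⟩
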